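/- arXiv:2411.12582 — 10 statements merged into one kernel-verified Lean document; each statement's English description precedes it below -/
import Mathlib

section
/- For every integer k ≥ 2 there exists a connected simple graph G with two vertex covers V_s ≠ V_t, each of size k, such that for every integer d ≥ 1 there is no reconfiguration sequence from V_s to V_t under (k−1, d)-Token Jumping in which every configuration is a vertex cover of G of size k. (Concretely, the cycle on 2k vertices with its two disjoint minimum vertex covers witnesses this.) -/
/-- A vertex cover of a simple graph: every edge has an endpoint in the set. -/
def IsVC {V : Type*} (G : SimpleGraph V) (S : Finset V) : Prop :=
  ∀ ⦃u v : V⦄, G.Adj u v → u ∈ S ∨ v ∈ S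

/-- A `(k', d)`-Token Jumping move from `C` to `C'`: a bijection moving each token
by distance at most `d`, with at most `k'` tokens actually moving. -/
def TJMove {V : Type*} (G : SimpleGraph V) (k' d : ℕ) (C C' : Finset V) : Prop :=
  ∃ f : V → V, Set.BijOn f ↑C ↑C' ∧ (∀ v ∈ C, G.dist v (f v) ≤ d) ∧
    {v | v ∈ C ∧ f v ≠ v}.ncard ≤ k'

theorem TJMove.card_le_of_disjoint {V : Type*} {G : SimpleGraph V} {k' d : ℕ} {C C' : Finset V}
    (h : TJMove G k' d C C') (hd : Disjoint C C') : C.card ≤ k' := by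
  obtain ⟨f, hf, -, hcard⟩ := h
  have hset : {v | v ∈ C ∧ f v ≠ v} = (C : Set V) := by
    ext v
    refine ⟨fun hv => hv.1, fun hv => ⟨hv, fun hfv => ?_⟩⟩
    have hv' : f v ∈ C' := hf.mapsTo hv
    rw [hfv] at hv'
    exact Finset.disjoint_left.mp hd hv hv'
  rwa [hset, Set.ncard_coe_finset] at hcard

/-- The complete bipartite graph with parts `S` and `Sᶜ`. -/
def bipartiteOn {V : Type*} (S : Finset V) : SimpleGraph V where
  Adj u v := ¬ (u ∈ S ↔ v ∈ S)
  symm := ⟨fun _ _ h h' => h h'.symm⟩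
  loopless := ⟨fun _ h => h Iff.rfl⟩

theorem bipartiteOn_connected {V : Type*} {S : Finset V} {a b : V} (ha : a ∈ S) (hb : b ∉ S) :
    (bipartiteOn S).Connected := by
  have hadj : ∀ {u v : V}, u ∈ S → v ∉ S → (bipartiteOn S).Adj u v :=
    fun hu hv h => hv (h.mp hu)
  have hreach : ∀ v, (bipartiteOn S).Reachable a v := by
    intro v
    by_cases hv : v ∈ S
    · exact (hadj ha hb).reachable.trans (hadj hv hb).symm.reachable
    · exact (hadj ha hv).reachable
  exact (SimpleGraph.connected_iff_exists_forall_reachable _).mpr ⟨a, hreach⟩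

theorem isVC_bipartiteOn_self {V : Type*} (S : Finset V) : IsVC (bipartiteOn S) S := by
  intro u v h
  change ¬ (u ∈ S ↔ v ∈ S) at h
  tauto

theorem isVC_bipartiteOn_compl {V : Type*} [Fintype V] [DecidableEq V] (S : Finset V) :
    IsVC (bipartiteOn S) Sᶜ := by
  intro u v h
  change ¬ (u ∈ S ↔ v ∈ S) at h
  simp only [Finset.mem_compl]
  tauto

/-- A vertex cover of a complete bipartite graph contains one of the two parts. -/
theorem IsVC.subset_or_compl_subset {V : Type*} [Fintype V] [DecidableEq V] {S T : Finset V}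
    (h : IsVC (bipartiteOn S) T) : S ⊆ T ∨ Sᶜ ⊆ T := by
  by_contra! hcon
  obtain ⟨⟨x, hxS, hxT⟩, y, hyS, hyT⟩ :=
    And.imp Finset.not_subset.mp Finset.not_subset.mp hcon
  have hadj : (bipartiteOn S).Adj x y := fun hxy => Finset.mem_compl.mp hyS (hxy.mp hxS)
  exact (h hadj).elim hxT hyT

theorem statement_0 (k : ℕ) (hk : 2 ≤ k) :
    ∃ (n : ℕ) (G : SimpleGraph (Fin n)) (Vs Vt : Finset (Fin n)),
      G.Connected ∧ Vs ≠ Vt ∧ Vs.card = k ∧ Vt.card = k ∧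
      IsVC G Vs ∧ IsVC G Vt ∧
      ∀ d : ℕ, 1 ≤ d →
        ¬ ∃ (L : ℕ) (C : ℕ → Finset (Fin n)),
            C 0 = Vs ∧ C L = Vt ∧
            (∀ i ≤ L, IsVC G (C i) ∧ (C i).card = k) ∧
            (∀ i < L, TJMove G (k - 1) d (C i) (C (i + 1))) := by
  obtain ⟨S, -, hS⟩ := Finset.exists_subset_card_eq
    (show k ≤ (Finset.univ : Finset (Fin (2 * k))).card by simp; omega)
  have hSc : Sᶜ.card = k := by rw [Finset.card_compl, hS, Fintype.card_fin]; omega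
  obtain ⟨a, ha⟩ : S.Nonempty := Finset.card_pos.mp (by omega)
  obtain ⟨b, hb⟩ : Sᶜ.Nonempty := Finset.card_pos.mp (by omega)
  have hne : S ≠ Sᶜ := fun h => Finset.mem_compl.mp (h ▸ ha) ha
  refine ⟨2 * k, bipartiteOn S, S, Sᶜ, bipartiteOn_connected ha (Finset.mem_compl.mp hb), hne,
    hS, hSc, isVC_bipartiteOn_self S, isVC_bipartiteOn_compl S, ?_⟩
  rintro d - ⟨L, C, h0, hL, hC, hmove⟩
  have hconst : ∀ i ≤ L, C i = S := by
    intro i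
    induction i with
    | zero => exact fun _ => h0
    | succ i ih =>
      intro hi
      obtain ⟨hvc, hcard⟩ := hC (i + 1) hi
      rcases hvc.subset_or_compl_subset with hsub | hsub
      · exact (Finset.eq_of_subset_of_card_le hsub (by omega)).symm
      · have heq := Finset.eq_of_subset_of_card_le hsub (by omega)
        have hm := hmove i (by omega)
        rw [ih (by omega), ← heq] at hm
        have := hm.card_le_of_disjoint disjoint_compl_right
        omega
  exact hne ((hconst L le_rfl).symm.trans hL)
end

section
/- For every integer k ≥ 2 there exists a connected simple graph G with two independent sets I_s ≠ I_t, each of size k, such that for every integer d ≥ 1 there is no reconfiguration sequence from I_s to I_t under (k−1, d)-Token Jumping in which every configuration is an independent set of G of size k. (Concretely, the cycle on 2k vertices with its two disjoint maximum independent sets witnesses this.) -/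
/-- An independent set of a simple graph: no two vertices in the set are adjacent. -/
def IsIS {V : Type*} (G : SimpleGraph V) (S : Finset V) : Prop :=
  ∀ u ∈ S, ∀ v ∈ S, ¬ G.Adj u v

/-- If fewer tokens move than there are tokens, then some token stays in place. -/
theorem TJMove.exists_mem_inter {V : Type*} {G : SimpleGraph V} {k' d : ℕ} {C C' : Finset V}
    (h : TJMove G k' d C C') (hlt : k' < C.card) : ∃ v ∈ C, v ∈ C' := by
  obtain ⟨f, hf, -, hmoved⟩ := h
  by_contra! hdisj
  have hall : {v | v ∈ C ∧ f v ≠ v} = (C : Set V) := by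
    ext v
    refine ⟨fun hv => hv.1, fun hv => ⟨hv, fun hfix => hdisj v hv ?_⟩⟩
    simpa [hfix] using hf.mapsTo hv
  rw [hall, Set.ncard_coe_finset] at hmoved
  omega

/-- The complete bipartite graph on `Fin (2 * k)` between the first `k` and the last `k`
vertices. -/
def halvesGraph (k : ℕ) : SimpleGraph (Fin (2 * k)) where
  Adj u v := ¬ (u.val < k ↔ v.val < k)
  symm := ⟨fun _ _ h h' => h h'.symm⟩
  loopless := ⟨fun _ h => h Iff.rfl⟩

theorem halvesGraph_connected {k : ℕ} (hk : 0 < k) : (halvesGraph k).Connected := by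
  let a : Fin (2 * k) := ⟨0, by omega⟩
  let b : Fin (2 * k) := ⟨k, by omega⟩
  have ha : a.val < k := hk
  have hb : ¬ b.val < k := lt_irrefl k
  have hab : (halvesGraph k).Reachable b a :=
    SimpleGraph.Adj.reachable (show ¬ (b.val < k ↔ a.val < k) by tauto)
  rw [SimpleGraph.connected_iff_exists_forall_reachable]
  refine ⟨a, fun u => SimpleGraph.Reachable.symm ?_⟩
  by_cases hu : u.val < k
  · exact (SimpleGraph.Adj.reachable (show ¬ (u.val < k ↔ b.val < k) by tauto)).trans hab
  · exact SimpleGraph.Adj.reachable (show ¬ (u.val < k ↔ a.val < k) by tauto)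

theorem statement_1 (k : ℕ) (hk : 2 ≤ k) :
    ∃ (n : ℕ) (G : SimpleGraph (Fin n)) (Is It : Finset (Fin n)),
      G.Connected ∧ Is ≠ It ∧ Is.card = k ∧ It.card = k ∧
      IsIS G Is ∧ IsIS G It ∧
      ∀ d : ℕ, 1 ≤ d →
        ¬ ∃ (L : ℕ) (C : ℕ → Finset (Fin n)),
            C 0 = Is ∧ C L = It ∧
            (∀ i ≤ L, IsIS G (C i) ∧ (C i).card = k) ∧
            (∀ i < L, TJMove G (k - 1) d (C i) (C (i + 1))) := by
  let low : Finset (Fin (2 * k)) := {u | u.val < k}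
  let high : Finset (Fin (2 * k)) := {u | ¬ u.val < k}
  have mem_low : ∀ u, u ∈ low ↔ u.val < k := fun u => by simp [low]
  have mem_high : ∀ u, u ∈ high ↔ ¬ u.val < k := fun u => by simp [high]
  have card_low : low.card = k := by
    simp only [low, Fin.card_filter_val_lt]
    omega
  have card_high : high.card = k := by
    have hsum : low.card + high.card = _ :=
      Finset.card_filter_add_card_filter_not (s := Finset.univ) (fun u : Fin (2 * k) => u.val < k)
    rw [Finset.card_univ, Fintype.card_fin] at hsum
    omega
  obtain ⟨w, hw⟩ : high.Nonempty := Finset.card_pos.mp (by omega)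
  have not_subset : ¬ high ⊆ low := fun h => (mem_high w).mp hw ((mem_low w).mp (h hw))
  refine ⟨2 * k, halvesGraph k, low, high, halvesGraph_connected (by omega),
    fun h => not_subset h.ge, card_low, card_high, ?_, ?_, ?_⟩
  · intro u hu v hv huv
    exact huv (iff_of_true ((mem_low u).mp hu) ((mem_low v).mp hv))
  · intro u hu v hv huv
    exact huv (iff_of_false ((mem_high u).mp hu) ((mem_high v).mp hv))
  · rintro d - ⟨L, C, hs, ht, hind, hmove⟩
    have stays_low : ∀ i ≤ L, C i ⊆ low := by
      intro i
      induction i with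
      | zero => exact fun _ => hs.subset
      | succ i ih =>
        intro hi u hu
        have hcard := (hind i (by omega)).2
        obtain ⟨v, hv, hv'⟩ := (hmove i (by omega)).exists_mem_inter (by omega)
        have hvk := (mem_low v).mp (ih (by omega) hv)
        have hiff : u.val < k ↔ v.val < k := not_not.mp ((hind (i + 1) hi).1 u hu v hv')
        exact (mem_low u).mpr (hiff.mpr hvk)
    exact not_subset (ht ▸ stays_low L le_rfl)
end

section
/- Let H = (V, F) be a hypergraph, let V_s and V_i be vertex covers of H, and let A ⊆ V_i. Then (V_i \ A) ∪ (N_H[A] ∩ V_s) is a vertex cover of H. -/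
/-- A vertex cover of a hypergraph with edge family `F`:
a set of vertices intersecting every edge. -/
def IsHVC {V : Type*} (F : Set (Set V)) (S : Set V) : Prop :=
  ∀ e ∈ F, ∃ v ∈ e, v ∈ S

/-- `N_H[A]`: all vertices at hypergraph distance at most 1 from some vertex of `A`,
i.e. the vertices of `A` together with all vertices sharing an edge with a vertex of `A`. -/
def hNbhd {V : Type*} (F : Set (Set V)) (A : Set V) : Set V :=
  {v | ∃ a ∈ A, a = v ∨ ∃ e ∈ F, a ∈ e ∧ v ∈ e}

theorem statement_5 {V : Type*} (F : Set (Set V)) (Vs Vi A : Set V)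
    (hVs : IsHVC F Vs) (hVi : IsHVC F Vi) (hA : A ⊆ Vi) :
    IsHVC F ((Vi \ A) ∪ (hNbhd F A ∩ Vs)) := by
  intro e he
  obtain ⟨v, hve, hv⟩ := hVi e he
  by_cases hvA : v ∈ A
  · obtain ⟨w, hwe, hw⟩ := hVs e he
    exact ⟨w, hwe, Or.inr ⟨⟨v, hvA, Or.inr ⟨e, he, hve, hwe⟩⟩, hw⟩⟩
  · exact ⟨v, hve, Or.inl ⟨hv, hvA⟩⟩
end

section
/- Let V_s and V_t be two vertex covers of a hypergraph H = (V, F). Then there exists a vertex cover V_m of H together with injective maps g_s : V_m → V_s and g_t : V_m → V_t such that dist_H(v, g_s(v)) ≤ 1 and dist_H(v, g_t(v)) ≤ 1 for every v ∈ V_m. -/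
/-- `u` and `v` are at hypergraph distance at most 1: equal or sharing an edge. -/
def hClose {V : Type*} (F : Set (Set V)) (u v : V) : Prop :=
  u = v ∨ ∃ e ∈ F, u ∈ e ∧ v ∈ e

theorem hClose_symm {V : Type*} {F : Set (Set V)} {u v : V} (h : hClose F u v) :
    hClose F v u := by
  rcases h with rfl | ⟨e, he, hu, hv⟩
  · exact Or.inl rfl
  · exact Or.inr ⟨e, he, hv, hu⟩

/-- `(A, C)` covers every pair of `S × T` related by `r`. -/
def IsPairCover {V : Type*} (r : V → V → Prop) (S T A C : Finset V) : Prop :=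
  A ⊆ S ∧ C ⊆ T ∧ ∀ s ∈ S, ∀ t ∈ T, r s t → s ∈ A ∨ t ∈ C

theorem IsPairCover.swap {V : Type*} {r : V → V → Prop} (hr : ∀ u v, r u v → r v u)
    {S T A C : Finset V} (h : IsPairCover r S T A C) : IsPairCover r T S C A :=
  ⟨h.2.1, h.1, fun t ht s hs hts => (h.2.2 s hs t ht (hr _ _ hts)).symm⟩

/-- In a bipartite vertex cover `(A, C)` of minimum size, `A` can be matched into `T \ C`. -/
theorem IsPairCover.exists_matching {V : Type*} [DecidableEq V] {r : V → V → Prop}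
    {S T A C : Finset V} (h : IsPairCover r S T A C)
    (hmin : ∀ A' C', IsPairCover r S T A' C' → A.card + C.card ≤ A'.card + C'.card) :
    ∃ f : V → V, Set.InjOn f A ∧ ∀ a ∈ A, f a ∈ T \ C ∧ r a (f a) := by
  classical
  obtain ⟨hA, hC, hcov⟩ := h
  have hall := (Finset.all_card_le_biUnion_card_iff_exists_injective
    (fun a : A => (T \ C).filter (r a))).1 fun X => by
      set N := X.biUnion fun a : A => (T \ C).filter (r a)
      set Y := X.map (Function.Embedding.subtype _)
      have hYA : Y ⊆ A := fun y hy => by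
        obtain ⟨x, -, rfl⟩ := Finset.mem_map.1 hy
        exact x.2
      have hcover : IsPairCover r S T (A \ Y) (C ∪ N) := by
        refine ⟨Finset.sdiff_subset.trans hA, Finset.union_subset hC ?_, ?_⟩
        · refine Finset.biUnion_subset.2 fun a _ => ?_
          exact (Finset.filter_subset _ _).trans Finset.sdiff_subset
        · intro s hs t ht hst
          by_cases htC : t ∈ C
          · exact Or.inr (Finset.mem_union_left _ htC)
          have hsA : s ∈ A := (hcov s hs t ht hst).resolve_right htC
          by_cases hsX : (⟨s, hsA⟩ : A) ∈ X
          · refine Or.inr (Finset.mem_union_right _ (Finset.mem_biUnion.2 ⟨_, hsX, ?_⟩))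
            simp [ht, htC, hst]
          · refine Or.inl (Finset.mem_sdiff.2 ⟨hsA, fun hsY => hsX ?_⟩)
            obtain ⟨x, hx, rfl⟩ := Finset.mem_map.1 hsY
            exact hx
      have h₁ := hmin _ _ hcover
      have h₂ := Finset.card_union_le C N
      have h₃ := Finset.card_sdiff_add_card_eq_card hYA
      have h₄ : Y.card = X.card := Finset.card_map _
      omega
  obtain ⟨f, hf, hfm⟩ := hall
  refine ⟨fun v => if hv : v ∈ A then f ⟨v, hv⟩ else v, ?_, ?_⟩
  · intro a ha b hb hab
    have ha' : a ∈ A := ha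
    have hb' : b ∈ A := hb
    simp only [ha', hb', dif_pos] at hab
    exact congrArg Subtype.val (hf hab)
  · intro a ha
    simpa only [ha, dif_pos] using Finset.mem_filter.1 (hfm ⟨a, ha⟩)

/-- Extend a matching of `C` into `S \ A` by the identity on `A`. -/
theorem exists_injOn_union {V : Type*} [DecidableEq V] {r : V → V → Prop} (hr : ∀ v, r v v)
    {S A C : Finset V} (hA : A ⊆ S) {f : V → V} (hf : Set.InjOn f C)
    (hfm : ∀ c ∈ C, f c ∈ S \ A ∧ r c (f c)) :
    ∃ g : V → V, Set.InjOn g ↑(A ∪ C) ∧ Set.MapsTo g ↑(A ∪ C) ↑S ∧ ∀ v ∈ A ∪ C, r v (g v) := by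
  refine ⟨fun v => if v ∈ A then v else f v, ?_, ?_, ?_⟩
  · intro a ha b hb hab
    simp only [Finset.coe_union, Set.mem_union, Finset.mem_coe] at ha hb
    have key := fun c hc => Finset.mem_sdiff.1 (hfm c hc).1
    by_cases haA : a ∈ A <;> by_cases hbA : b ∈ A <;> simp only [haA, hbA, if_true, if_false] at hab
    · exact hab
    · exact absurd (hab ▸ haA) (key b (hb.resolve_left hbA)).2
    · exact absurd (hab ▸ hbA) (key a (ha.resolve_left haA)).2
    · exact hf (ha.resolve_left haA) (hb.resolve_left hbA) hab
  · intro a ha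
    simp only [Finset.coe_union, Set.mem_union, Finset.mem_coe] at ha ⊢
    split_ifs with haA
    · exact hA haA
    · exact (Finset.mem_sdiff.1 (hfm a (ha.resolve_left haA)).1).1
  · intro a ha
    dsimp only
    split_ifs with haA
    · exact hr a
    · exact (hfm a ((Finset.mem_union.1 ha).resolve_left haA)).2

theorem statement_6 {V : Type*} (F : Set (Set V)) (Vs Vt : Finset V)
    (hs : IsHVC F ↑Vs) (ht : IsHVC F ↑Vt) :
    ∃ Vm : Finset V, IsHVC F ↑Vm ∧
      ∃ gs gt : V → V,
        Set.InjOn gs ↑Vm ∧ Set.MapsTo gs ↑Vm ↑Vs ∧ (∀ v ∈ Vm, hClose F v (gs v)) ∧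
        Set.InjOn gt ↑Vm ∧ Set.MapsTo gt ↑Vm ↑Vt ∧ (∀ v ∈ Vm, hClose F v (gt v)) := by
  classical
  have hsymm : ∀ u v, hClose F u v → hClose F v u := fun _ _ => hClose_symm
  have hrefl : ∀ v, hClose F v v := fun _ => Or.inl rfl
  obtain ⟨⟨A, C⟩, hAC, hmin⟩ := exists_minimalFor_of_wellFoundedLT
    (fun p : Finset V × Finset V => IsPairCover (hClose F) Vs Vt p.1 p.2)
    (fun p => p.1.card + p.2.card)
    ⟨(Vs, Vt), subset_rfl, subset_rfl, fun _ h _ _ _ => Or.inl h⟩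
  have hmin' : ∀ A' C', IsPairCover (hClose F) Vs Vt A' C' →
      A.card + C.card ≤ A'.card + C'.card := fun A' C' h => by
    rcases le_total (A.card + C.card) (A'.card + C'.card) with hle | hle
    · exact hle
    · exact hmin (j := (A', C')) h hle
  obtain ⟨f, hf, hfm⟩ := hAC.exists_matching hmin'
  obtain ⟨g, hg, hgm⟩ := (hAC.swap hsymm).exists_matching fun C' A' h => by
    simpa only [add_comm] using hmin' A' C' (h.swap hsymm)
  obtain ⟨gs, hgs⟩ := exists_injOn_union hrefl hAC.1 hg hgm
  obtain ⟨gt, hgt⟩ := exists_injOn_union hrefl hAC.2.1 hf hfm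
  rw [Finset.union_comm] at hgt
  refine ⟨A ∪ C, fun e he => ?_, gs, gt, hgs.1, hgs.2.1, hgs.2.2, hgt.1, hgt.2.1, hgt.2.2⟩
  obtain ⟨s, hse, hsV⟩ := hs e he
  obtain ⟨t, hte, htV⟩ := ht e he
  rcases hAC.2.2 s hsV t htV (Or.inr ⟨e, he, hse, hte⟩) with h | h
  · exact ⟨s, hse, Finset.mem_union_left _ h⟩
  · exact ⟨t, hte, Finset.mem_union_right _ h⟩
end

section
/- Let G be a connected simple graph with n vertices and diameter at most d, and let D_s and D_t be two dominating sets of G, each of size k. Then there exists a sequence D_s = C_0, C_1, …, C_ℓ = D_t with ℓ ≤ n·d + 2 such that every C_i is a dominating set of G of size exactly k and, for each i, there is a (k,1; k−2,2)-Token Jumping move from C_i to C_{i+1}. -/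
/-- A dominating set of a simple graph: every vertex is in the set or adjacent to it. -/
def IsDS {V : Type*} (G : SimpleGraph V) (S : Finset V) : Prop :=
  ∀ v : V, v ∈ S ∨ ∃ u ∈ S, G.Adj u v

/-- A `(k,1; k',d)`-Token Jumping move from `C` to `C'`: a bijection for which there is a
subset `D'` of `C` of size at most `k'` whose tokens move by distance at most `d`, while
all other tokens move by distance at most 1. -/
def TJ2Move {V : Type*} (G : SimpleGraph V) (k' d : ℕ) (C C' : Finset V) : Prop :=
  ∃ f : V → V, Set.BijOn f ↑C ↑C' ∧
    ∃ D' : Finset V, D' ⊆ C ∧ D'.card ≤ k' ∧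
      (∀ v ∈ D', G.dist v (f v) ≤ d) ∧
      (∀ v ∈ C, v ∉ D' → G.dist v (f v) ≤ 1)

/-- A self-map of a finite type without fixed points along the orbit of `x₀` agrees with some
permutation at two distinct points, and this permutation follows the map wherever it moves. -/
theorem exists_perm_of_iterate_ne {α : Type*} [Finite α] (f : α → α) (x₀ : α)
    (h : ∀ n, f (f^[n] x₀) ≠ f^[n] x₀) :
    ∃ π : Equiv.Perm α, ∃ x y, x ≠ y ∧ π x = f x ∧ π y = f y ∧ ∀ z, π z = f z ∨ π z = z := by
  classical
  have hb := Function.bijOn_periodicPts f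
  let g : α → α := fun z => if z ∈ Function.periodicPts f then f z else z
  have hg : Function.Injective g := by
    intro a b hab
    by_cases ha : a ∈ Function.periodicPts f <;> by_cases hb' : b ∈ Function.periodicPts f <;>
      simp only [g, ha, hb', if_true, if_false] at hab
    · exact hb.injOn ha hb' hab
    · exact absurd (hab ▸ hb.mapsTo ha) hb'
    · exact absurd (hab ▸ hb.mapsTo hb') ha
    · exact hab
  obtain ⟨m, n, hmn, he⟩ : ∃ m n, m < n ∧ f^[m] x₀ = f^[n] x₀ := by
    obtain ⟨a, b, hab, he⟩ := Finite.exists_ne_map_eq_of_infinite (fun n : ℕ => f^[n] x₀)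
    rcases lt_or_gt_of_ne hab with hl | hl
    · exact ⟨a, b, hl, he⟩
    · exact ⟨b, a, hl, he.symm⟩
  have hx : f^[m] x₀ ∈ Function.periodicPts f := by
    refine ⟨n - m, by omega, ?_⟩
    rw [Function.IsPeriodicPt, Function.IsFixedPt, ← Function.iterate_add_apply,
      Nat.sub_add_cancel hmn.le, he]
  refine ⟨Equiv.ofBijective g (Finite.injective_iff_bijective.mp hg), f^[m] x₀, f (f^[m] x₀),
    (h m).symm, if_pos hx, if_pos (hb.mapsTo hx), fun z => ?_⟩
  by_cases hz : z ∈ Function.periodicPts f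
  · exact Or.inl (if_pos hz)
  · exact Or.inr (if_neg hz)

/-- In a finite digraph with at least two vertices in which every vertex has an incoming and an
outgoing arc, some permutation follows arcs at all the points it moves and at two or more points
in total. -/
theorem exists_perm_two_arcs {α : Type*} [Finite α] [Nontrivial α] (R : α → α → Prop)
    (hout : ∀ x, ∃ y, R x y) (hin : ∀ y, ∃ x, R x y) :
    ∃ π : Equiv.Perm α, ∃ x y, x ≠ y ∧ R x (π x) ∧ R y (π y) ∧ ∀ z, R z (π z) ∨ π z = z := by
  classical
  by_cases hloops : ∃ x y, x ≠ y ∧ R x x ∧ R y y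
  · obtain ⟨x, y, hxy, hx, hy⟩ := hloops
    exact ⟨1, x, y, hxy, hx, hy, fun z => Or.inr rfl⟩
  have huniq : ∀ x y, R x x → R y y → x = y := fun x y hx hy => by
    by_contra hne
    exact hloops ⟨x, y, hne, hx, hy⟩
  by_cases hent : ∃ p x, R p p ∧ x ≠ p ∧ R x p
  · obtain ⟨p, x, hp, hxp, hx⟩ := hent
    choose g hg using hin
    have hg' : ∀ y, R (Function.update g p x y) y := by
      intro y
      by_cases hy : y = p
      · subst hy; simpa using hx
      · simpa [hy] using hg y
    have hne : ∀ y, Function.update g p x y ≠ y := by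
      intro y hfix
      have hyp : y = p := huniq y p (by simpa [hfix] using hg' y) hp
      subst hyp
      exact hxp (by simpa using hfix)
    obtain ⟨π, a, b, hab, ha, hb, hall⟩ :=
      exists_perm_of_iterate_ne (Function.update g p x) p (fun n => hne _)
    refine ⟨π.symm, π a, π b, fun h => hab (π.injective h), ?_, ?_, fun z => ?_⟩
    · rw [Equiv.symm_apply_apply, ha]
      exact hg' a
    · rw [Equiv.symm_apply_apply, hb]
      exact hg' b
    · rcases hall (π.symm z) with h | h
      · left
        have := hg' (π.symm z)
        rw [← h] at this
        simpa using this
      · right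
        simpa using h.symm
  · choose f hf using hout
    obtain ⟨x₀, hx₀⟩ : ∃ x₀, ¬ R x₀ x₀ := by
      obtain ⟨a, b, hab⟩ := exists_pair_ne α
      by_contra hcon
      push Not at hcon
      exact hab (huniq a b (hcon a) (hcon b))
    have hiter : ∀ n, ¬ R (f^[n] x₀) (f^[n] x₀) := by
      intro n
      induction n with
      | zero => exact hx₀
      | succ n ih =>
        rw [Function.iterate_succ_apply']
        intro hloop
        refine hent ⟨_, f^[n] x₀, hloop, fun he => ih ?_, hf _⟩
        rw [← he] at hloop
        exact hloop
    obtain ⟨π, a, b, hab, ha, hb, hall⟩ := exists_perm_of_iterate_ne f x₀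
      (fun n he => hiter n (by simpa [he] using hf (f^[n] x₀)))
    refine ⟨π, a, b, hab, ha ▸ hf a, hb ▸ hf b, fun z => ?_⟩
    exact (hall z).imp_left fun h : π z = f z => h.symm ▸ hf z

section Domination

variable {V : Type*} {G : SimpleGraph V}

theorem IsDS.exists_dist_le_one {S : Finset V} (hS : IsDS G S) (v : V) :
    ∃ u ∈ S, G.dist u v ≤ 1 := by
  rcases hS v with h | ⟨u, hu, huv⟩
  · exact ⟨v, h, by simp⟩
  · exact ⟨u, hu, (SimpleGraph.dist_eq_one_iff_adj.mpr huv).le⟩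

theorem IsDS.mono {S T : Finset V} (hS : IsDS G S) (hST : S ⊆ T) : IsDS G T := fun v =>
  (hS v).imp (fun h => hST h) (fun ⟨u, hu, huv⟩ => ⟨u, hST hu, huv⟩)

theorem isDS_of_exists_dist_le_one (hconn : G.Connected) {S : Finset V}
    (hS : ∀ v, ∃ u ∈ S, G.dist u v ≤ 1) : IsDS G S := by
  intro v
  obtain ⟨u, hu, huv⟩ := hS v
  rcases Nat.le_one_iff_eq_zero_or_eq_one.mp huv with h | h
  · exact Or.inl ((hconn.dist_eq_zero_iff.mp h) ▸ hu)
  · exact Or.inr ⟨u, hu, SimpleGraph.dist_eq_one_iff_adj.mp h⟩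

/-- A bijection between dominating sets moving every token by at most 2 can be rerouted so that
two of the tokens move by at most 1. -/
theorem tj2Move_of_bijOn {A B : Finset V} (hA : IsDS G A) (hB : IsDS G B) {f : V → V}
    (hf : Set.BijOn f ↑A ↑B) (hdist : ∀ v ∈ A, G.dist v (f v) ≤ 2) :
    TJ2Move G (A.card - 2) 2 A B := by
  classical
  rcases Nat.lt_or_ge A.card 2 with hcard | hcard
  · refine ⟨f, hf, ∅, by simp, by simp, by simp, fun v hv _ => ?_⟩
    obtain ⟨u, hu, huv⟩ := hB.exists_dist_le_one v
    obtain ⟨w, hw, rfl⟩ := hf.surjOn hu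
    rw [Finset.card_le_one.mp (by omega) v hv w hw] at huv ⊢
    rwa [SimpleGraph.dist_comm]
  have : Nontrivial A := (Finset.one_lt_card_iff_nontrivial.mp hcard).coe_sort
  obtain ⟨π, x, y, hxy, hx, hy, hall⟩ :=
    exists_perm_two_arcs (fun u w : A => G.dist (u : V) (f w) ≤ 1)
      (fun u => by
        obtain ⟨v, hv, hvu⟩ := hB.exists_dist_le_one (u : V)
        obtain ⟨w, hw, rfl⟩ := hf.surjOn hv
        exact ⟨⟨w, hw⟩, by rwa [SimpleGraph.dist_comm]⟩)
      (fun w => by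
        obtain ⟨u, hu, huw⟩ := hA.exists_dist_le_one (f w)
        exact ⟨⟨u, hu⟩, huw⟩)
  let g : V → V := fun u => if h : u ∈ A then f (π ⟨u, h⟩) else u
  have hg : ∀ u : A, g u = f (π u) := fun u => dif_pos u.2
  refine ⟨g, ⟨fun u hu => ?_, fun u hu w hw huw => ?_, fun v hv => ?_⟩,
    (A.erase x).erase y, fun u hu => Finset.mem_of_mem_erase (Finset.mem_of_mem_erase hu),
    ?_, fun u hu => ?_, fun u hu hu' => ?_⟩
  · rw [hg ⟨u, hu⟩]
    exact hf.mapsTo (π _).2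
  · rw [hg ⟨u, hu⟩, hg ⟨w, hw⟩] at huw
    simpa using π.injective (Subtype.ext (hf.injOn (π _).2 (π _).2 huw))
  · obtain ⟨w, hw, rfl⟩ := hf.surjOn hv
    refine ⟨(π.symm ⟨w, hw⟩ : A), (π.symm ⟨w, hw⟩).2, ?_⟩
    rw [hg, Equiv.apply_symm_apply]
  · rw [Finset.card_erase_of_mem, Finset.card_erase_of_mem x.2]
    · omega
    · exact Finset.mem_erase.mpr ⟨fun h => hxy (Subtype.ext h.symm), y.2⟩
  · have hu : u ∈ A := Finset.mem_of_mem_erase (Finset.mem_of_mem_erase hu)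
    rw [hg ⟨u, hu⟩]
    rcases hall ⟨u, hu⟩ with h | h
    · exact le_trans h one_le_two
    · rw [h]
      exact hdist u hu
  · have huxy : u = y ∨ u = x := by
      by_contra! h
      exact hu' (Finset.mem_erase.mpr ⟨h.1, Finset.mem_erase.mpr ⟨h.2, hu⟩⟩)
    rcases huxy with rfl | rfl
    · rw [hg]; exact hy
    · rw [hg]; exact hx

/-- A minimum dominating set injects into every dominating set along distances at most 2. -/
theorem exists_injective_of_minimum (hconn : G.Connected) {M D : Finset V} (hM : IsDS G M)
    (hmin : ∀ S : Finset V, IsDS G S → M.card ≤ S.card) (hD : IsDS G D) :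
    ∃ τ : M → V, Function.Injective τ ∧ ∀ v, τ v ∈ D ∧ G.dist (v : V) (τ v) ≤ 2 := by
  classical
  obtain ⟨τ, hinj, hτ⟩ := (Finset.all_card_le_biUnion_card_iff_exists_injective
    (fun v : M => D.filter (fun u => G.dist (v : V) u ≤ 2))).mp (by
      intro s
      set T := s.biUnion (fun v : M => D.filter (fun u => G.dist (v : V) u ≤ 2)) with hT
      set S := s.map (Function.Embedding.subtype _) with hS
      have hSM : S ⊆ M := by
        intro v hv
        simp only [hS, Finset.mem_map, Function.Embedding.subtype_apply] at hv
        obtain ⟨w, _, rfl⟩ := hv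
        exact w.2
      have hdom : IsDS G ((M \ S) ∪ T) := by
        refine isDS_of_exists_dist_le_one hconn fun v => ?_
        obtain ⟨m, hm, hmv⟩ := hM.exists_dist_le_one v
        by_cases hmS : m ∈ S
        · obtain ⟨u, hu, huv⟩ := hD.exists_dist_le_one v
          refine ⟨u, Finset.mem_union_right _ ?_, huv⟩
          simp only [hS, Finset.mem_map, Function.Embedding.subtype_apply] at hmS
          obtain ⟨w, hw, rfl⟩ := hmS
          refine Finset.mem_biUnion.mpr ⟨w, hw, Finset.mem_filter.mpr ⟨hu, ?_⟩⟩
          have := hconn.dist_triangle (u := (w : V)) (v := v) (w := u)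
          rw [SimpleGraph.dist_comm (u := v)] at this
          omega
        · exact ⟨m, Finset.mem_union_left _ (Finset.mem_sdiff.mpr ⟨hm, hmS⟩), hmv⟩
      have h1 := hmin _ hdom
      have h2 := Finset.card_union_le (M \ S) T
      have h3 := Finset.card_sdiff_add_card_eq_card hSM
      have h4 : S.card = s.card := Finset.card_map _
      omega)
  exact ⟨τ, hinj, fun v => Finset.mem_filter.mp (hτ v)⟩

/-- Every dominating set is within one distance-2 shift of a superset of a given minimum
dominating set. -/
theorem exists_superset_bijOn [Finite V] (hconn : G.Connected) {M D : Finset V}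
    (hM : IsDS G M) (hmin : ∀ S : Finset V, IsDS G S → M.card ≤ S.card) (hD : IsDS G D) :
    ∃ X : Finset V, M ⊆ X ∧ ∃ g : V → V, Set.BijOn g ↑X ↑D ∧ ∀ v ∈ X, G.dist v (g v) ≤ 2 := by
  classical
  let P : (M → V) → Prop := fun τ =>
    Function.Injective τ ∧ ∀ v, τ v ∈ D ∧ G.dist (v : V) (τ v) ≤ 2
  have hne : Nonempty {τ // P τ} :=
    let ⟨τ, hτ⟩ := exists_injective_of_minimum hconn hM hmin hD
    ⟨⟨τ, hτ⟩⟩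
  obtain ⟨⟨τ, hinj, hτ⟩, hleast⟩ :=
    Finite.exists_min (fun τ : {τ // P τ} => ∑ v : M, G.dist (v : V) (τ.1 v))
  -- Minimality of the total distance forces unmatched tokens to lie outside `M`.
  have hfree : ∀ u ∈ D, (∀ v, τ v ≠ u) → u ∉ M := by
    intro u huD hun huM
    have hP : P (Function.update τ ⟨u, huM⟩ u) := by
      refine ⟨fun a b hab => ?_, fun v => ?_⟩
      · by_cases ha : a = ⟨u, huM⟩ <;> by_cases hb : b = ⟨u, huM⟩ <;>
          simp only [Function.update_apply, ha, hb, if_true, if_false] at hab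
        · rw [ha, hb]
        · exact absurd hab.symm (hun b)
        · exact absurd hab (hun a)
        · exact hinj hab
      · by_cases hv : v = ⟨u, huM⟩
        · subst hv; simpa using huD
        · simpa [hv] using hτ v
    refine absurd (hleast ⟨_, hP⟩) (not_le.mpr ?_)
    refine Finset.sum_lt_sum (fun v _ => ?_) ⟨⟨u, huM⟩, Finset.mem_univ _, ?_⟩
    · by_cases hv : v = ⟨u, huM⟩
      · subst hv; simp
      · simp [hv]
    · simpa using hconn.pos_dist_of_ne (hun ⟨u, huM⟩).symm
  let g : V → V := fun v => if h : v ∈ M then τ ⟨v, h⟩ else v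
  have hgM : ∀ v (h : v ∈ M), g v = τ ⟨v, h⟩ := fun v h => dif_pos h
  have hgn : ∀ v, v ∉ M → g v = v := fun v h => dif_neg h
  have hX : ∀ v, v ∈ M ∪ D.filter (fun u => ∀ w, τ w ≠ u) →
      v ∉ M → v ∈ D ∧ ∀ w, τ w ≠ v := fun v hv hvM => by
    simpa [hvM] using hv
  refine ⟨M ∪ D.filter (fun u => ∀ v, τ v ≠ u), Finset.subset_union_left, g,
    ⟨fun v hv => ?_, fun v hv w hw hvw => ?_, fun u hu => ?_⟩, fun v hv => ?_⟩
  · by_cases hvM : v ∈ M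
    · rw [hgM v hvM]; exact (hτ _).1
    · rw [hgn v hvM]; exact (hX v hv hvM).1
  · by_cases hvM : v ∈ M <;> by_cases hwM : w ∈ M
    · rw [hgM v hvM, hgM w hwM] at hvw
      simpa using hinj hvw
    · rw [hgM v hvM, hgn w hwM] at hvw
      exact absurd hvw ((hX w hw hwM).2 _)
    · rw [hgn v hvM, hgM w hwM] at hvw
      exact absurd hvw.symm ((hX v hv hvM).2 _)
    · rwa [hgn v hvM, hgn w hwM] at hvw
  · by_cases hun : ∀ v, τ v ≠ u
    · exact ⟨u, Finset.mem_union_right _ (Finset.mem_filter.mpr ⟨hu, hun⟩),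
        hgn u (hfree u hu hun)⟩
    · push Not at hun
      obtain ⟨v, rfl⟩ := hun
      exact ⟨v, Finset.mem_union_left _ v.2, hgM v v.2⟩
  · by_cases hvM : v ∈ M
    · rw [hgM v hvM]; exact (hτ ⟨v, hvM⟩).2
    · rw [hgn v hvM]; simp

/-- Pushing the tokens of a path by one position each, when only its end is free. -/
theorem exists_bijOn_of_isPath [DecidableEq V] {x w : V} (q : G.Walk x w) :
    ∀ S : Finset V, q.IsPath → x ∉ S → w ∉ S → (∀ v ∈ q.support, v ≠ x → v ≠ w → v ∈ S) →
      ∃ f : V → V, Set.BijOn f ↑(insert x S) ↑(insert w S) ∧ ∀ v, G.dist v (f v) ≤ 1 := by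
  induction q with
  | nil => exact fun S _ _ _ _ => ⟨id, Set.bijOn_id _, by simp⟩
  | @cons x z w hxz q ih =>
    intro S hpath hx hw hint
    rw [SimpleGraph.Walk.cons_isPath_iff] at hpath
    have hxw : x ≠ w := fun h => hpath.2 (h ▸ q.end_mem_support)
    obtain ⟨f, hf, hdist⟩ : ∃ f : V → V,
        Set.BijOn f ↑S (↑(insert w S) \ {z}) ∧ ∀ v, G.dist v (f v) ≤ 1 := by
      by_cases hzw : z = w
      · subst hzw
        refine ⟨id, ?_, by simp⟩
        convert Set.bijOn_id (S : Set V) using 1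
        simp [hw]
      · have hz : z ∈ S := hint z (by simp) hxz.ne' hzw
        obtain ⟨f, hf, hdist⟩ := ih (S.erase z) hpath.1 (by simp) (by simp [hw])
          (fun v hv hvz hvw => Finset.mem_erase.mpr ⟨hvz, hint v (by simp [hv])
            (fun h => hpath.2 (h ▸ hv)) hvw⟩)
        rw [Finset.insert_erase hz] at hf
        refine ⟨f, ?_, hdist⟩
        convert hf using 1
        ext v
        simp only [Finset.coe_insert, Finset.coe_erase, Set.mem_sdiff, Set.mem_insert_iff,
          Set.mem_singleton_iff]
        grind
    have hzS : z ∈ insert w S := by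
      by_cases hzw : z = w
      · simp [hzw]
      · exact Finset.mem_insert_of_mem (hint z (by simp) hxz.ne' hzw)
    have hupd : ∀ v ∈ S, Function.update f x z v = f v := fun v hv =>
      Function.update_of_ne (fun h : v = x => hx (h ▸ hv)) _ _
    refine ⟨Function.update f x z, ?_, fun v => ?_⟩
    · have hbij : Set.BijOn (Function.update f x z) ↑S (↑(insert w S) \ {z}) :=
        hf.congr fun v hv => (hupd v hv).symm
      have := hbij.insert (a := x) (by simp)
      rw [Function.update_self, Set.insert_sdiff_singleton, Set.insert_eq_of_mem hzS] at this
      rwa [Finset.coe_insert]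
    · by_cases hv : v = x
      · subst hv
        simpa using (SimpleGraph.dist_eq_one_iff_adj.mpr hxz).le
      · simpa [hv] using hdist v

end Domination

/-- `b` is reachable from `a` by at most `n` steps of the relation `R`. -/
def ReachWithin {α : Type*} (R : α → α → Prop) (n : ℕ) (a b : α) : Prop :=
  ∃ L ≤ n, ∃ C : ℕ → α, C 0 = a ∧ C L = b ∧ ∀ i < L, R (C i) (C (i + 1))

namespace ReachWithin

variable {α : Type*} {R : α → α → Prop} {m n : ℕ} {a b c : α}

theorem refl (R : α → α → Prop) (n : ℕ) (a : α) : ReachWithin R n a a :=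
  ⟨0, Nat.zero_le n, fun _ => a, rfl, rfl, by simp⟩

theorem single (h : R a b) : ReachWithin R 1 a b :=
  ⟨1, le_rfl, fun i => if i = 0 then a else b, by simp, by simp, fun i hi => by
    obtain rfl : i = 0 := by omega
    simpa using h⟩

theorem mono (h : ReachWithin R m a b) (hmn : m ≤ n) : ReachWithin R n a b :=
  let ⟨L, hL, hC⟩ := h
  ⟨L, hL.trans hmn, hC⟩

theorem trans (hab : ReachWithin R m a b) (hbc : ReachWithin R n b c) :
    ReachWithin R (m + n) a c := by
  obtain ⟨L, hL, C, hC0, hCL, hC⟩ := hab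
  obtain ⟨L', hL', C', hC0', hCL', hC'⟩ := hbc
  refine ⟨L + L', by omega, fun i => if i ≤ L then C i else C' (i - L), by simp [hC0], ?_,
    fun i hi => ?_⟩
  · by_cases h : L' = 0
    · subst h
      simp [hCL, ← hCL', hC0']
    · simp [h, hCL']
  · rcases lt_trichotomy i L with h | h | h
    · simpa [h.le, Nat.succ_le_of_lt h] using hC i h
    · subst h
      simpa [hCL, hC0'] using hC' 0 (by omega)
    · have := hC' (i - L) (by omega)
      simpa [not_le.mpr h, show ¬ i + 1 ≤ L by omega, show i + 1 - L = i - L + 1 by omega]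
        using this

end ReachWithin

/-- A token-jumping step between dominating sets of size `k`. -/
def DSStep {V : Type*} (G : SimpleGraph V) (k : ℕ) (A B : Finset V) : Prop :=
  (IsDS G A ∧ A.card = k) ∧ (IsDS G B ∧ B.card = k) ∧ TJ2Move G (k - 2) 2 A B

section Sliding

variable {V : Type*} {G : SimpleGraph V} {k : ℕ}

theorem dsStep_of_walk [DecidableEq V] {S : Finset V} (hS : IsDS G S) (hk : S.card + 1 = k)
    {x w : V} (hx : x ∉ S) (hw : w ∉ S) (q : G.Walk x w)
    (hq : ∀ v ∈ q.support, v ≠ x → v ≠ w → v ∈ S) :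
    DSStep G k (insert x S) (insert w S) := by
  obtain ⟨f, hf, hdist⟩ := exists_bijOn_of_isPath q.bypass S q.bypass_isPath hx hw
    (fun v hv => hq v (q.support_bypass_subset_support hv))
  refine ⟨⟨hS.mono (Finset.subset_insert _ _), ?_⟩, ⟨hS.mono (Finset.subset_insert _ _), ?_⟩,
    f, hf, ∅, by simp, by simp, by simp, fun v _ _ => hdist v⟩
  · rw [Finset.card_insert_of_notMem hx, hk]
  · rw [Finset.card_insert_of_notMem hw, hk]

/-- A token can slide along a walk over a dominating set `S` of other tokens. Here `q` is the
stretch of occupied vertices traversed since the last position `x` of the free token. -/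
theorem reachWithin_of_walk [DecidableEq V] {S : Finset V} (hS : IsDS G S)
    (hk : S.card + 1 = k) {z y : V} (p : G.Walk z y) (hy : y ∉ S) :
    ∀ x (q : G.Walk x z), x ∉ S → (∀ v ∈ q.support, v ≠ x → v ∈ S) →
      ReachWithin (DSStep G k) p.length (insert x S) (insert y S) := by
  induction p with
  | @nil z =>
    intro x q hx hq
    obtain rfl : z = x := by
      by_contra h
      exact hy (hq z q.end_mem_support h)
    exact ReachWithin.refl _ _ _
  | @cons z z' y hzz p ih =>
    intro x q hx hq
    rw [SimpleGraph.Walk.length_cons]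
    by_cases hz' : z' ∈ S
    · refine (ih hy x (q.concat hzz) hx fun v hv hvx => ?_).mono (Nat.le_succ _)
      rw [SimpleGraph.Walk.support_concat] at hv
      simp only [List.mem_append, List.mem_singleton] at hv
      rcases hv with hv | rfl
      · exact hq v hv hvx
      · exact hz'
    · have hstep : DSStep G k (insert x S) (insert z' S) := by
        refine dsStep_of_walk hS hk hx hz' (q.concat hzz) fun v hv hvx hvz => ?_
        rw [SimpleGraph.Walk.support_concat] at hv
        simp only [List.mem_append, List.mem_singleton] at hv
        exact hq v (hv.resolve_right hvz) hvx
      rw [add_comm]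
      exact (ReachWithin.single hstep).trans
        (ih hy z' SimpleGraph.Walk.nil hz' (fun v hv hvz => absurd (by simpa using hv) hvz))

/-- Two supersets of a common dominating set are connected by sliding the remaining tokens one
after another. -/
theorem reachWithin_of_superset [DecidableEq V] {d : ℕ} (hconn : G.Connected)
    (hdiam : ∀ u v : V, G.dist u v ≤ d) {M Y : Finset V} (hM : IsDS G M) (hMY : M ⊆ Y)
    (hY : Y.card = k) (r : ℕ) :
    ∀ X : Finset V, M ⊆ X → X.card = k → (X \ Y).card = r →
      ReachWithin (DSStep G k) (r * d) X Y := by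
  induction r with
  | zero =>
    intro X _ hX hr
    rw [Finset.card_eq_zero, Finset.sdiff_eq_empty_iff_subset] at hr
    rw [Finset.eq_of_subset_of_card_le hr (by omega)]
    exact ReachWithin.refl _ _ _
  | succ r ih =>
    intro X hMX hX hr
    obtain ⟨x, hx⟩ : (X \ Y).Nonempty := Finset.card_pos.mp (by omega)
    obtain ⟨y, hy⟩ : (Y \ X).Nonempty := by
      rw [← Finset.card_pos, Finset.card_sdiff_comm (hY.trans hX.symm)]
      omega
    rw [Finset.mem_sdiff] at hx hy
    have hMS : M ⊆ X.erase x := fun v hv =>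
      Finset.mem_erase.mpr ⟨fun h => hx.2 (h ▸ hMY hv), hMX hv⟩
    have hcard : (X.erase x).card + 1 = k := by
      rw [Finset.card_erase_add_one hx.1, hX]
    have hyS : y ∉ X.erase x := fun h => hy.2 (Finset.mem_of_mem_erase h)
    obtain ⟨p, hp⟩ := hconn.exists_walk_length_eq_dist x y
    have hslide := reachWithin_of_walk (hM.mono hMS) hcard p hyS x SimpleGraph.Walk.nil (by simp)
      (fun v hv hvx => absurd (by simpa using hv) hvx)
    rw [Finset.insert_erase hx.1] at hslide
    have hrest := ih (insert y (X.erase x)) (hMS.trans (Finset.subset_insert _ _))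
      (by rw [Finset.card_insert_of_notMem hyS, hcard])
      (by
        rw [Finset.insert_sdiff_of_mem _ hy.1, Finset.erase_sdiff_comm,
          Finset.card_erase_of_mem (Finset.mem_sdiff.mpr hx), hr]
        rfl)
    rw [Nat.succ_mul, add_comm]
    exact (hslide.mono (hp ▸ hdiam x y)).trans hrest

end Sliding

theorem statement_9 {V : Type*} [Fintype V] (G : SimpleGraph V) (d k : ℕ)
    (hconn : G.Connected) (hdiam : ∀ u v : V, G.dist u v ≤ d)
    (Ds Dt : Finset V) (hDs : IsDS G Ds) (hDt : IsDS G Dt)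
    (hs : Ds.card = k) (ht : Dt.card = k) :
    ∃ L : ℕ, L ≤ Fintype.card V * d + 2 ∧
      ∃ C : ℕ → Finset V, C 0 = Ds ∧ C L = Dt ∧
        (∀ i ≤ L, IsDS G (C i) ∧ (C i).card = k) ∧
        ∀ i < L, TJ2Move G (k - 2) 2 (C i) (C (i + 1)) := by
  classical
  obtain ⟨⟨M, hM⟩, hmin⟩ : ∃ M : {S : Finset V // IsDS G S}, ∀ S : {S : Finset V // IsDS G S},
      M.1.card ≤ S.1.card :=
    have : Nonempty {S : Finset V // IsDS G S} := ⟨⟨Ds, hDs⟩⟩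
    Finite.exists_min _
  have hmin : ∀ S : Finset V, IsDS G S → M.card ≤ S.card := fun S hS => hmin ⟨S, hS⟩
  obtain ⟨X, hMX, g, hg, hgdist⟩ := exists_superset_bijOn hconn hM hmin hDs
  obtain ⟨Y, hMY, h, hh, hhdist⟩ := exists_superset_bijOn hconn hM hmin hDt
  have hXk : X.card = k := by rw [← hs]; exact_mod_cast hg.finsetCard_eq
  have hYk : Y.card = k := by rw [← ht]; exact_mod_cast hh.finsetCard_eq
  have hX := hM.mono hMX
  have hY := hM.mono hMY
  have hfirst : DSStep G k Ds X := by
    have := hconn.nonempty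
    refine ⟨⟨hDs, hs⟩, ⟨hX, hXk⟩, hs ▸ tj2Move_of_bijOn hDs hX
      (hg.symm hg.invOn_invFunOn.symm) fun v hv => ?_⟩
    obtain ⟨w, hw, rfl⟩ := hg.surjOn hv
    rw [hg.invOn_invFunOn.1 hw, SimpleGraph.dist_comm]
    exact hgdist w hw
  have hlast : DSStep G k Y Dt := ⟨⟨hY, hYk⟩, ⟨hDt, ht⟩, hYk ▸ tj2Move_of_bijOn hY hDt hh hhdist⟩
  obtain ⟨L, hL, C, hC0, hCL, hC⟩ := ((ReachWithin.single hfirst).trans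
    (reachWithin_of_superset hconn hdiam hM hMY hYk _ X hMX hXk rfl)).trans
    (ReachWithin.single hlast)
  refine ⟨L, ?_, C, hC0, hCL, fun i hi => ?_, fun i hi => (hC i hi).2.2⟩
  · have := Nat.mul_le_mul_right d (Finset.card_le_univ (X \ Y))
    omega
  · rcases hi.lt_or_eq with h | rfl
    · exact (hC i h).1
    · rw [hCL]
      exact ⟨hDt, ht⟩
end

section
/- For every integer k ≥ 3 there exists a connected simple graph G whose minimum dominating sets have size k and which has exactly two distinct minimum dominating sets D_a and D_b, such that: (i) for every integer d ≥ 1 there is no reconfiguration sequence from D_a to D_b under (k−1, d)-Token Jumping through dominating sets of size k, and (ii) for every integer d ≥ 1 there is no reconfiguration sequence from D_a to D_b under (k,1; k−3,d)-Token Jumping through dominating sets of size k. That is, reconfiguring between them requires all k tokens to move at once, with at least k−2 of them moving to distance at least 2. -/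
/-- Vertices of the gadget: two rows of `k` token positions, and `k + 1` private copies of a
connector for every pair of positions from different rows. -/
abbrev GadgetVertex (k : ℕ) : Type := (Fin k ⊕ Fin k) ⊕ (Fin k × Fin k × Fin (k + 1))

/-- Adjacency in one direction: the first position of each row is joined to the whole other row,
and the connectors of `(i, j)` are joined to the two positions `i` and `j`. -/
def gadgetRel (k : ℕ) : GadgetVertex k → GadgetVertex k → Prop
  | .inl (.inl i), .inl (.inr j) => i.val = 0 ∨ j.val = 0
  | .inl (.inl i), .inr (i', _, _) => i = i'
  | .inl (.inr j), .inr (_, j', _) => j = j'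
  | _, _ => False

/-- The graph whose only minimum dominating sets are its two rows. -/
def gadgetGraph (k : ℕ) : SimpleGraph (GadgetVertex k) where
  Adj u v := gadgetRel k u v ∨ gadgetRel k v u
  symm := ⟨fun _ _ h => h.symm⟩
  loopless := ⟨by rintro ((i | j) | ⟨i, j, c⟩) <;> simp [gadgetRel]⟩

/-- The first row of the gadget. -/
def rowA (k : ℕ) : Finset (GadgetVertex k) :=
  Finset.univ.map (Function.Embedding.inl.trans Function.Embedding.inl)

/-- The second row of the gadget. -/
def rowB (k : ℕ) : Finset (GadgetVertex k) :=
  Finset.univ.map (Function.Embedding.inr.trans Function.Embedding.inl)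

lemma card_rowA (k : ℕ) : (rowA k).card = k := by simp [rowA]

lemma card_rowB (k : ℕ) : (rowB k).card = k := by simp [rowB]

lemma disjoint_rows (k : ℕ) : Disjoint (rowA k) (rowB k) := by
  simp [Finset.disjoint_left, rowA, rowB]

lemma isDS_rowA {k : ℕ} (hk : 0 < k) : IsDS (gadgetGraph k) (rowA k) := by
  rintro ((i | j) | ⟨i, j, c⟩)
  · exact .inl (by simp [rowA])
  · exact .inr ⟨.inl (.inl ⟨0, hk⟩), by simp [rowA], by simp [gadgetGraph, gadgetRel]⟩
  · exact .inr ⟨.inl (.inl i), by simp [rowA], by simp [gadgetGraph, gadgetRel]⟩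

lemma isDS_rowB {k : ℕ} (hk : 0 < k) : IsDS (gadgetGraph k) (rowB k) := by
  rintro ((i | j) | ⟨i, j, c⟩)
  · exact .inr ⟨.inl (.inr ⟨0, hk⟩), by simp [rowB], by simp [gadgetGraph, gadgetRel]⟩
  · exact .inl (by simp [rowB])
  · exact .inr ⟨.inl (.inr j), by simp [rowB], by simp [gadgetGraph, gadgetRel]⟩

lemma gadgetGraph_connected {k : ℕ} (hk : 0 < k) : (gadgetGraph k).Connected := by
  rw [SimpleGraph.connected_iff_exists_forall_reachable]
  refine ⟨.inl (.inl ⟨0, hk⟩), ?_⟩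
  have hB (j : Fin k) : (gadgetGraph k).Reachable (.inl (.inl ⟨0, hk⟩)) (.inl (.inr j)) :=
    SimpleGraph.Adj.reachable (by simp [gadgetGraph, gadgetRel])
  rintro ((i | j) | ⟨i, j, c⟩)
  · exact (hB ⟨0, hk⟩).trans (SimpleGraph.Adj.reachable (by simp [gadgetGraph, gadgetRel]))
  · exact hB j
  · exact (hB j).trans (SimpleGraph.Adj.reachable (by simp [gadgetGraph, gadgetRel]))

/-- Some connector of `(i, j)` lies outside a small set, so one of its two neighbours is inside. -/
lemma IsDS.mem_or_mem {k : ℕ} {D : Finset (GadgetVertex k)} (hD : IsDS (gadgetGraph k) D)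
    (hc : D.card ≤ k) (i j : Fin k) : .inl (.inl i) ∈ D ∨ .inl (.inr j) ∈ D := by
  obtain ⟨c, hcD⟩ : ∃ c : Fin (k + 1), .inr (i, j, c) ∉ D := by
    by_contra! h
    have := Finset.card_le_card_of_injOn (s := (Finset.univ : Finset (Fin (k + 1)))) (t := D)
      (fun c => .inr (i, j, c)) (fun c _ => h c) (fun c _ c' _ h => by simpa using h)
    simp at this
    omega
  obtain h | ⟨(i' | j') | w, hu, hadj⟩ := hD (.inr (i, j, c))
  · exact absurd h hcD
  · obtain rfl : i' = i := by simpa [gadgetGraph, gadgetRel] using hadj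
    exact .inl hu
  · obtain rfl : j' = j := by simpa [gadgetGraph, gadgetRel] using hadj
    exact .inr hu
  · simp [gadgetGraph, gadgetRel] at hadj

lemma IsDS.eq_row {k : ℕ} {D : Finset (GadgetVertex k)} (hD : IsDS (gadgetGraph k) D)
    (hc : D.card ≤ k) : D = rowA k ∨ D = rowB k := by
  by_cases h : rowA k ⊆ D
  · exact .inl (Finset.eq_of_subset_of_card_le h (by rwa [card_rowA])).symm
  · obtain ⟨i, hi⟩ : ∃ i : Fin k, .inl (.inl i) ∉ D := by
      simpa [rowA, Finset.subset_iff] using h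
    refine .inr (Finset.eq_of_subset_of_card_le ?_ (by rwa [card_rowB])).symm
    intro v hv
    obtain ⟨j, rfl⟩ : ∃ j : Fin k, .inl (.inr j) = v := by simpa [rowB] using hv
    exact (hD.mem_or_mem hc i j).resolve_left hi

lemma eq_corner_of_adj {k : ℕ} (hk : 0 < k) {u v : GadgetVertex k} (hu : u ∈ rowA k)
    (hv : v ∈ rowB k) (h : (gadgetGraph k).Adj u v) :
    u = .inl (.inl ⟨0, hk⟩) ∨ v = .inl (.inr ⟨0, hk⟩) := by
  obtain ⟨i, rfl⟩ : ∃ i : Fin k, .inl (.inl i) = u := by simpa [rowA] using hu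
  obtain ⟨j, rfl⟩ : ∃ j : Fin k, .inl (.inr j) = v := by simpa [rowB] using hv
  simpa [gadgetGraph, gadgetRel, Fin.ext_iff] using h

lemma isDS_comap_equiv {V W : Type*} (G : SimpleGraph W) (e : V ≃ W) (S : Finset V) :
    IsDS (G.comap e) S ↔ IsDS G (S.map e.toEmbedding) := by
  simp only [IsDS, e.surjective.forall, e.surjective.exists]
  simp

lemma exists_step_of_two_states {α : Type*} {a b : α} (hab : a ≠ b) {L : ℕ} {C : ℕ → α}
    (h0 : C 0 = a) (hL : C L = b) (h : ∀ i ≤ L, C i = a ∨ C i = b) :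
    ∃ i < L, C i = a ∧ C (i + 1) = b := by
  by_contra! hstep
  have hconst (i : ℕ) : i ≤ L → C i = a := by
    induction i with
    | zero => exact fun _ => h0
    | succ i ih =>
      intro hi
      exact (h _ hi).resolve_right (hstep i hi (ih (by omega)))
  exact hab ((hconst L le_rfl).symm.trans hL)

lemma not_tjMove_of_disjoint {V : Type*} {G : SimpleGraph V} {k' d : ℕ} {C C' : Finset V}
    (hdisj : Disjoint C C') (hk' : k' < C.card) : ¬ TJMove G k' d C C' := by
  rintro ⟨f, hf, -, hle⟩
  have hset : {v | v ∈ C ∧ f v ≠ v} = (C : Set V) := by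
    ext v
    simp only [Set.mem_ofPred_eq, Finset.mem_coe, and_iff_left_iff_imp]
    intro hv heq
    exact Finset.disjoint_left.mp hdisj hv (heq ▸ hf.mapsTo hv)
  rw [hset, Set.ncard_coe_finset] at hle
  omega

/-- If two vertices `p`, `q` cover all edges between disjoint sets `C` and `C'`, then at most two
tokens can slide along edges. -/
lemma not_tj2Move_of_cover {V : Type*} {G : SimpleGraph V} (hG : G.Connected) {k' d : ℕ}
    {C C' : Finset V} (hdisj : Disjoint C C') (p q : V)
    (hcover : ∀ u ∈ C, ∀ v ∈ C', G.Adj u v → u = p ∨ v = q) (hk' : k' + 2 < C.card) :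
    ¬ TJ2Move G k' d C C' := by
  classical
  rintro ⟨f, hf, D', hD', hcard, -, hnear⟩
  have hfq : (C.filter (f · = q)).card ≤ 1 := by
    rw [Finset.card_le_one]
    intro u hu v hv
    rw [Finset.mem_filter] at hu hv
    exact hf.injOn hu.1 hv.1 (hu.2.trans hv.2.symm)
  have hsub : C ⊆ D' ∪ ({p} ∪ C.filter (f · = q)) := by
    intro v hv
    by_cases hvD : v ∈ D'
    · simp [hvD]
    have hmem : f v ∈ C' := hf.mapsTo hv
    have hne : v ≠ f v := fun h => Finset.disjoint_left.mp hdisj hv (h ▸ hmem)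
    have hadj : G.Adj v (f v) := by
      rw [← SimpleGraph.dist_eq_one_iff_adj]
      have := hG.pos_dist_of_ne hne
      have := hnear v hv hvD
      omega
    rcases hcover v hv (f v) hmem hadj with h | h <;> simp [h, hv]
  have := Finset.card_le_card hsub
  have := Finset.card_union_le D' ({p} ∪ C.filter (f · = q))
  have := Finset.card_union_le {p} (C.filter (f · = q))
  have := Finset.card_singleton p
  omega

theorem statement_10 (k : ℕ) (hk : 3 ≤ k) :
    ∃ (n : ℕ) (G : SimpleGraph (Fin n)) (Da Db : Finset (Fin n)),
      G.Connected ∧ Da ≠ Db ∧ Da.card = k ∧ Db.card = k ∧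
      IsDS G Da ∧ IsDS G Db ∧
      (∀ D : Finset (Fin n), IsDS G D → k ≤ D.card) ∧
      (∀ D : Finset (Fin n), IsDS G D → D.card = k → D = Da ∨ D = Db) ∧
      (∀ d : ℕ, 1 ≤ d →
        ¬ ∃ (L : ℕ) (C : ℕ → Finset (Fin n)),
            C 0 = Da ∧ C L = Db ∧
            (∀ i ≤ L, IsDS G (C i) ∧ (C i).card = k) ∧
            (∀ i < L, TJMove G (k - 1) d (C i) (C (i + 1)))) ∧
      (∀ d : ℕ, 1 ≤ d →
        ¬ ∃ (L : ℕ) (C : ℕ → Finset (Fin n)),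
            C 0 = Da ∧ C L = Db ∧
            (∀ i ≤ L, IsDS G (C i) ∧ (C i).card = k) ∧
            (∀ i < L, TJ2Move G (k - 3) d (C i) (C (i + 1)))) := by
  have hk0 : 0 < k := by omega
  let e : Fin (Fintype.card (GadgetVertex k)) ≃ GadgetVertex k := (Fintype.equivFin _).symm
  let G := (gadgetGraph k).comap e
  let Da := (rowA k).map e.symm.toEmbedding
  let Db := (rowB k).map e.symm.toEmbedding
  have mapDa : Da.map e.toEmbedding = rowA k := by ext; simp [Da]
  have mapDb : Db.map e.toEmbedding = rowB k := by ext; simp [Db]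
  have hconn : G.Connected :=
    (SimpleGraph.Iso.comap e (gadgetGraph k)).connected_iff.mpr (gadgetGraph_connected hk0)
  have hcardA : Da.card = k := by rw [Finset.card_map, card_rowA]
  have hcardB : Db.card = k := by rw [Finset.card_map, card_rowB]
  have hdisj : Disjoint Da Db := (Finset.disjoint_map _).mpr (disjoint_rows k)
  have hne : Da ≠ Db := by
    intro h
    rw [h, disjoint_self] at hdisj
    simp [hdisj] at hcardB
    omega
  have hrows (D) (hD : IsDS G D) (hc : D.card ≤ k) : D = Da ∨ D = Db := by
    have := ((isDS_comap_equiv _ e D).mp hD).eq_row (by rwa [Finset.card_map])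
    rwa [← mapDa, ← mapDb, Finset.map_inj, Finset.map_inj] at this
  have hcover : ∀ u ∈ Da, ∀ v ∈ Db, G.Adj u v →
      u = e.symm (.inl (.inl ⟨0, hk0⟩)) ∨ v = e.symm (.inl (.inr ⟨0, hk0⟩)) := by
    intro u hu v hv h
    rw [e.eq_symm_apply, e.eq_symm_apply]
    refine eq_corner_of_adj hk0 ?_ ?_ h
    · exact mapDa ▸ Finset.mem_map_of_mem e.toEmbedding hu
    · exact mapDb ▸ Finset.mem_map_of_mem e.toEmbedding hv
  refine ⟨_, G, Da, Db, hconn, hne, hcardA, hcardB, ?_, ?_, ?_, ?_, ?_, ?_⟩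
  · rw [isDS_comap_equiv, mapDa]
    exact isDS_rowA hk0
  · rw [isDS_comap_equiv, mapDb]
    exact isDS_rowB hk0
  · intro D hD
    by_contra! hlt
    rcases hrows D hD hlt.le with rfl | rfl <;> omega
  · exact fun D hD hc => hrows D hD hc.le
  · rintro d - ⟨L, C, h0, hL, hC, hmove⟩
    obtain ⟨i, hi, hia, hib⟩ := exists_step_of_two_states hne h0 hL
      fun i hi => hrows _ (hC i hi).1 (hC i hi).2.le
    have := hmove i hi
    rw [hia, hib] at this
    exact not_tjMove_of_disjoint hdisj (by omega) this
  · rintro d - ⟨L, C, h0, hL, hC, hmove⟩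
    obtain ⟨i, hi, hia, hib⟩ := exists_step_of_two_states hne h0 hL
      fun i hi => hrows _ (hC i hi).1 (hC i hi).2.le
    have := hmove i hi
    rw [hia, hib] at this
    exact not_tj2Move_of_cover hconn hdisj _ _ hcover (by omega) this
end

section
/- Let G be a connected simple graph with n vertices, let I* be a maximal independent set of G, and let I_s ⊆ I* and I_t ⊆ I* be two independent sets of G, each of size k. Then there exists a sequence I_s = C_0, C_1, …, C_ℓ = I_t with ℓ ≤ n² such that every C_i is an independent set of G of size exactly k and, for each i, C_{i+1} is obtained from C_i by moving a single token by distance at most 3 (i.e., there is a bijection f : C_i → C_{i+1} with dist_G(v, f(v)) ≤ 3 for all v and f(v) ≠ v for at most one vertex v). -/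
/-- An independent set (as a set of vertices) of a simple graph. -/
def IndepSet {V : Type*} (G : SimpleGraph V) (S : Set V) : Prop :=
  ∀ u ∈ S, ∀ v ∈ S, ¬ G.Adj u v

open scoped Classical in
/-- The token sliding graph of `H`: two configurations are adjacent when one is obtained from the
other by sliding one token along an edge of `H` to an unoccupied vertex. -/
def tokenSlidingGraph {V : Type*} (H : SimpleGraph V) : SimpleGraph (Finset V) where
  Adj C C' := ∃ u ∈ C, ∃ v ∉ C, H.Adj u v ∧ C' = insert v (C.erase u)
  symm := ⟨by
    rintro C _ ⟨u, hu, v, hv, huv, rfl⟩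
    have hne := huv.ne
    refine ⟨v, by simp, u, by simp [hne], huv.symm, ?_⟩
    grind⟩
  loopless := ⟨by
    rintro C ⟨u, hu, v, hv, huv, h⟩
    exact hv (h ▸ Finset.mem_insert_self v _)⟩

open scoped Classical in
/-- A token can be carried along a walk of `H`, using at most one slide per edge of the walk. -/
theorem tokenSlidingGraph_exists_walk_exchange {V : Type*} {H : SimpleGraph V} {s t : V}
    (p : H.Walk s t) (C : Finset V) (hs : s ∈ C) (ht : t ∉ C) :
    ∃ q : (tokenSlidingGraph H).Walk C (insert t (C.erase s)), q.length ≤ p.length := by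
  induction p generalizing C with
  | nil => exact absurd hs ht
  | @cons s x t h p ih =>
    have hsx := h.ne
    by_cases hx : x ∈ C
    · obtain ⟨q, hq⟩ := ih C hx ht
      have hadj : (tokenSlidingGraph H).Adj (insert t (C.erase x)) (insert t (C.erase s)) :=
        ⟨s, by grind, x, by grind, h, by grind⟩
      exact ⟨q.concat hadj, by simpa using hq⟩
    · have hadj : (tokenSlidingGraph H).Adj C (insert x (C.erase s)) := ⟨s, hs, x, hx, h, rfl⟩
      by_cases hxt : x = t
      · subst hxt
        exact ⟨hadj.toWalk, by simp⟩
      · obtain ⟨q, hq⟩ := ih (insert x (C.erase s)) (by simp) (by grind)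
        have he : insert t ((insert x (C.erase s)).erase x) = insert t (C.erase s) := by grind
        exact ⟨.cons hadj (q.copy rfl he), by simpa using hq⟩

open scoped Classical in
/-- Configurations of equal size are joined by few slides when their vertices are mutually
reachable. -/
theorem tokenSlidingGraph_exists_walk {V : Type*} [Fintype V] {H : SimpleGraph V}
    (A B : Finset V) (hcard : A.card = B.card) (hreach : ∀ a ∈ A, ∀ b ∈ B, H.Reachable a b) :
    ∃ q : (tokenSlidingGraph H).Walk A B, q.length ≤ (A \ B).card * Fintype.card V := by
  induction hm : (A \ B).card generalizing A with
  | zero =>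
    have hAB : A = B := Finset.eq_of_subset_of_card_le
      (Finset.sdiff_eq_empty_iff_subset.mp (Finset.card_eq_zero.mp hm)) hcard.ge
    subst hAB
    exact ⟨.nil, by simp⟩
  | succ m ih =>
    obtain ⟨s, hs⟩ : (A \ B).Nonempty := Finset.card_pos.mp (by omega)
    obtain ⟨t, ht⟩ : (B \ A).Nonempty := Finset.card_pos.mp (by
      have := Finset.card_sdiff_comm hcard; omega)
    rw [Finset.mem_sdiff] at hs ht
    obtain ⟨p⟩ := hreach s hs.1 t ht.1
    obtain ⟨q, hq⟩ := tokenSlidingGraph_exists_walk_exchange p.toPath.1 A hs.1 ht.2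
    have hp := p.toPath.2.length_lt
    obtain ⟨r, hr⟩ := ih (insert t (A.erase s)) (by
        rw [Finset.card_insert_of_notMem (by grind), Finset.card_erase_add_one hs.1, hcard])
      (fun a ha b hb => by
        rcases Finset.mem_insert.mp ha with rfl | ha
        · exact (hreach s hs.1 a ht.1).symm.trans (hreach s hs.1 b hb)
        · exact hreach a (Finset.mem_of_mem_erase ha) b hb)
      (by
        have he : insert t (A.erase s) \ B = (A \ B).erase s := by
          rw [Finset.insert_sdiff_of_mem _ ht.1, Finset.erase_sdiff_comm]
        rw [he, Finset.card_erase_of_mem (Finset.mem_sdiff.mpr hs), hm, Nat.add_sub_cancel])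
    refine ⟨q.append r, ?_⟩
    rw [SimpleGraph.Walk.length_append, Nat.succ_mul]
    omega

/-- The graph on `I` joining distinct vertices at `G`-distance at most `3`. -/
def nearGraph {V : Type*} (G : SimpleGraph V) (I : Set V) : SimpleGraph V where
  Adj u v := u ≠ v ∧ u ∈ I ∧ v ∈ I ∧ G.dist u v ≤ 3
  symm := ⟨fun _ _ h => ⟨h.1.symm, h.2.2.1, h.2.1, G.dist_comm ▸ h.2.2.2⟩⟩
  loopless := ⟨fun _ h => h.1 rfl⟩

theorem IndepSet.exists_dist_le_one {V : Type*} {G : SimpleGraph V} {I : Set V}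
    (hI : IndepSet G I) (hmax : ∀ J : Set V, IndepSet G J → I ⊆ J → J = I) (v : V) :
    ∃ a ∈ I, G.dist a v ≤ 1 := by
  by_contra! h
  have hadj : ∀ a ∈ I, ¬ G.Adj a v := fun a ha hav => by
    have := SimpleGraph.dist_eq_one_iff_adj.mpr hav
    have := h a ha
    omega
  have hJ : IndepSet G (insert v I) := by
    rintro x (rfl | hx) y (rfl | hy)
    · exact G.irrefl
    · exact fun hxy => hadj y hy hxy.symm
    · exact hadj x hx
    · exact hI x hx y hy
  have hv : v ∈ I := hmax _ hJ (Set.subset_insert v I) ▸ Set.mem_insert v I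
  have := h v hv
  simp at this

theorem nearGraph_reachable {V : Type*} {G : SimpleGraph V} (hconn : G.Connected) {I : Set V}
    (hdom : ∀ v, ∃ a ∈ I, G.dist a v ≤ 1) {a b : V} (ha : a ∈ I) (hb : b ∈ I) :
    (nearGraph G I).Reachable a b := by
  have near : ∀ {a b}, a ∈ I → b ∈ I → G.dist a b ≤ 3 → (nearGraph G I).Reachable a b := by
    intro a b ha hb hab
    by_cases h : a = b
    · exact h ▸ .refl _
    · exact SimpleGraph.Adj.reachable ⟨h, ha, hb, hab⟩
  have key : ∀ {u v} (_ : G.Walk u v) (a), a ∈ I → G.dist a u ≤ 1 → v ∈ I →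
      (nearGraph G I).Reachable a v := by
    intro u v p
    induction p with
    | nil => exact fun a ha hau hv => near ha hv (hau.trans (by norm_num))
    | @cons u w v h p ih =>
      intro a ha hau hv
      obtain ⟨c, hc, hcw⟩ := hdom w
      refine (near ha hc ?_).trans (ih c hc hcw hv)
      have h1 := hconn.dist_triangle (u := a) (v := u) (w := c)
      have h2 := hconn.dist_triangle (u := u) (v := w) (w := c)
      have h3 := SimpleGraph.dist_eq_one_iff_adj.mpr h
      have h4 := G.dist_comm (u := w) (v := c)
      omega
  obtain ⟨p⟩ := hconn.preconnected a b
  exact key p a ha (by simp) hb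

theorem TJMove.of_tokenSlidingGraph_adj {V : Type*} {G : SimpleGraph V} {I : Set V}
    {C C' : Finset V} (h : (tokenSlidingGraph (nearGraph G I)).Adj C C') : TJMove G 1 3 C C' := by
  classical
  obtain ⟨u, hu, v, hv, huv, rfl⟩ := h
  have hne := huv.ne
  refine ⟨fun x => if x = u then v else x, ⟨?_, ?_, ?_⟩, ?_, ?_⟩
  · intro x hx
    simp only [Finset.mem_coe] at *
    grind
  · intro x hx y hy
    simp only [Finset.mem_coe] at *
    grind
  · intro y hy
    simp only [Finset.mem_coe, Set.mem_image] at *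
    by_cases hyv : y = v
    · exact ⟨u, by grind⟩
    · exact ⟨y, by grind⟩
  · intro x hx
    by_cases hxu : x = u
    · simpa [hxu] using huv.2.2.2
    · simp [hxu]
  · refine (Set.ncard_le_ncard (t := {u}) ?_).trans (Set.ncard_singleton u).le
    rintro x ⟨-, hx⟩
    by_contra hxu
    exact hx (if_neg hxu)

theorem tokenSlidingGraph_adj_card {V : Type*} {H : SimpleGraph V} {C C' : Finset V}
    (h : (tokenSlidingGraph H).Adj C C') : C'.card = C.card := by
  classical
  obtain ⟨u, hu, v, hv, huv, rfl⟩ := h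
  rw [Finset.card_insert_of_notMem (by grind), Finset.card_erase_add_one hu]

theorem tokenSlidingGraph_nearGraph_adj_subset {V : Type*} {G : SimpleGraph V} {I : Set V}
    {C C' : Finset V} (h : (tokenSlidingGraph (nearGraph G I)).Adj C C') (hC : ↑C ⊆ I) :
    ↑C' ⊆ I := by
  classical
  obtain ⟨u, hu, v, hv, huv, rfl⟩ := h
  intro x hx
  rcases Finset.mem_insert.mp hx with rfl | hx
  · exact huv.2.2.1
  · exact hC (Finset.mem_of_mem_erase hx)

theorem statement_12 {V : Type*} [Fintype V] (G : SimpleGraph V) (hconn : G.Connected)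
    (I : Set V) (hI : IndepSet G I)
    (hmax : ∀ J : Set V, IndepSet G J → I ⊆ J → J = I)
    (k : ℕ) (Is It : Finset V) (hIsub : ↑Is ⊆ I) (hItub : ↑It ⊆ I)
    (hIsI : IsIS G Is) (hItI : IsIS G It)
    (hs : Is.card = k) (ht : It.card = k) :
    ∃ L : ℕ, L ≤ Fintype.card V ^ 2 ∧
      ∃ C : ℕ → Finset V, C 0 = Is ∧ C L = It ∧
        (∀ i ≤ L, IsIS G (C i) ∧ (C i).card = k) ∧
        ∀ i < L, TJMove G 1 3 (C i) (C (i + 1)) := by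
  classical
  obtain ⟨q, hq⟩ := tokenSlidingGraph_exists_walk (H := nearGraph G I) Is It (hs.trans ht.symm)
    fun a ha b hb => nearGraph_reachable hconn (hI.exists_dist_le_one hmax) (hIsub ha) (hItub hb)
  have inv : ∀ i ≤ q.length, ↑(q.getVert i) ⊆ I ∧ (q.getVert i).card = k := by
    intro i
    induction i with
    | zero => exact fun _ => by simpa using ⟨hIsub, hs⟩
    | succ i ih =>
      intro hi
      have hadj := q.adj_getVert_succ (i := i) (by omega)
      obtain ⟨h1, h2⟩ := ih (by omega)
      exact ⟨tokenSlidingGraph_nearGraph_adj_subset hadj h1,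
        (tokenSlidingGraph_adj_card hadj).trans h2⟩
  refine ⟨q.length, hq.trans ?_, q.getVert, q.getVert_zero, q.getVert_length, fun i hi => ?_,
    fun i hi => .of_tokenSlidingGraph_adj (q.adj_getVert_succ hi)⟩
  · rw [sq]
    exact Nat.mul_le_mul_right _ (Finset.card_le_univ _)
  · obtain ⟨h1, h2⟩ := inv i hi
    exact ⟨fun u hu v hv => hI u (h1 hu) v (h1 hv), h2⟩
end

section
/- Let G be a simple graph, let I_s and I_i be independent sets of G, and let A ⊆ I_s. Then (I_i \ N_G[A]) ∪ A is an independent set of G. Moreover, if I_s, I_i and A are finite and |A| > |N_G[A] ∩ I_i|, then |(I_i \ N_G[A]) ∪ A| > |I_i|. -/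
/-- The closed neighborhood `N_G[A]` of a set `A` of vertices: `A` together with
all vertices adjacent to some vertex of `A`. -/
def closedNbhd {V : Type*} (G : SimpleGraph V) (A : Set V) : Set V :=
  A ∪ {v | ∃ a ∈ A, G.Adj a v}

theorem statement_14 {V : Type*} (G : SimpleGraph V) (Is Ii A : Set V)
    (hIs : IndepSet G Is) (hIi : IndepSet G Ii) (hA : A ⊆ Is) :
    IndepSet G ((Ii \ closedNbhd G A) ∪ A) ∧
    (Is.Finite → Ii.Finite → A.Finite →
      (closedNbhd G A ∩ Ii).ncard < A.ncard →
      Ii.ncard < ((Ii \ closedNbhd G A) ∪ A).ncard) := by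
  refine ⟨?_, fun _ hfin hAfin hlt => ?_⟩
  · rintro u (⟨hu, hu'⟩ | hu) v (⟨hv, hv'⟩ | hv) huv
    · exact hIi u hu v hv huv
    · exact hu' (Or.inr ⟨v, hv, huv.symm⟩)
    · exact hv' (Or.inr ⟨u, hu, huv⟩)
    · exact hIs u (hA hu) v (hA hv) huv
  · have hdisj : Disjoint (Ii \ closedNbhd G A) A :=
      Set.disjoint_left.mpr fun _ hx hxA => hx.2 (Or.inl hxA)
    rw [Set.ncard_union_eq hdisj hfin.sdiff hAfin]
    have hsplit := Set.ncard_inter_add_ncard_sdiff_eq_ncard Ii (closedNbhd G A) hfin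
    rw [Set.inter_comm] at hsplit
    omega
end

section
/- For every integer k ≥ 3 there exists a connected simple graph G with two independent sets I_s ≠ I_t, each of size k, such that there is no reconfiguration sequence from I_s to I_t under (k, 2)-Token Jumping in which every configuration is an independent set of G of size k. That is, allowing some token to move to distance at least 3 is necessary to guarantee reachability for independent sets. -/
/-- The graph joining vertices on consecutive levels of `h`. -/
def levelGraph {V : Type*} (h : V → ℕ) : SimpleGraph V where
  Adj u v := h u + 1 = h v ∨ h v + 1 = h u
  symm := ⟨fun _ _ huv => huv.symm⟩
  loopless := ⟨fun _ huv => by omega⟩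

theorem levelGraph_level_le_add_length {V : Type*} (h : V → ℕ) {u v : V}
    (p : (levelGraph h).Walk u v) : h v ≤ h u + p.length := by
  induction p with
  | nil => simp
  | cons huv p ih =>
    have huv' : _ ∨ _ := huv
    rw [SimpleGraph.Walk.length_cons]
    omega

theorem levelGraph_level_le_add_dist {V : Type*} (h : V → ℕ) (hc : (levelGraph h).Connected)
    (u v : V) : h v ≤ h u + (levelGraph h).dist u v := by
  obtain ⟨p, hp⟩ := hc.exists_walk_length_eq_dist u v
  exact hp ▸ levelGraph_level_le_add_length h p

/-- Levels of the double star on `2 * k` vertices with centres `k - 1` and `k`, each of which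
carries `k - 1` leaves. -/
def doubleStarLevel (k : ℕ) (v : Fin (2 * k)) : ℕ :=
  if v.val < k - 1 then 0 else if v.val = k - 1 then 1 else if v.val = k then 2 else 3

theorem doubleStar_connected {k : ℕ} (hk : 2 ≤ k) :
    (levelGraph (doubleStarLevel k)).Connected := by
  have hadj : (levelGraph (doubleStarLevel k)).Adj ⟨k - 1, by omega⟩ ⟨k, by omega⟩ := by
    simp only [levelGraph, doubleStarLevel]
    grind
  refine (SimpleGraph.connected_iff_exists_forall_reachable _).2 ⟨⟨k - 1, by omega⟩, fun v => ?_⟩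
  rcases lt_trichotomy v.val (k - 1) with hv | hv | hv
  · refine SimpleGraph.Adj.reachable ?_
    simp only [levelGraph, doubleStarLevel]
    grind
  · rw [show v = ⟨k - 1, by omega⟩ from Fin.ext hv]
  · rcases eq_or_ne v.val k with hv' | hv'
    · rw [show v = ⟨k, by omega⟩ from Fin.ext hv']
      exact hadj.reachable
    · refine hadj.reachable.trans (SimpleGraph.Adj.reachable ?_)
      simp only [levelGraph, doubleStarLevel]
      grind

/-- An independent `k`-set of the double star with at least `k - 1` vertices off the second set of
leaves contains the whole first set of leaves. -/
theorem doubleStar_leaves_subset {k : ℕ} (hk : 3 ≤ k) {a : Fin (2 * k)} (ha : a.val = k - 1)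
    {C D : Finset (Fin (2 * k))} (hC : IsIS (levelGraph (doubleStarLevel k)) C)
    (hCcard : C.card = k) (hDC : D ⊆ C) (hDcard : D.card = k - 1)
    (hD : ∀ v ∈ D, doubleStarLevel k v ≤ 2) : Finset.Iio a ⊆ C := by
  have haIio : (Finset.Iio a).card = k - 1 := by rw [Fin.card_Iio, ha]
  have hadj : ∀ u ∈ C, ∀ v ∈ C, doubleStarLevel k u + 1 ≠ doubleStarLevel k v :=
    fun u hu v hv huv => hC u hu v hv (Or.inl huv)
  have haC : a ∉ C := by
    intro haC
    have hsub : D ⊆ {a} := by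
      intro v hv
      have h1 := hadj a haC v (hDC hv)
      have h2 := hadj v (hDC hv) a haC
      have h3 := hD v hv
      rw [Finset.mem_singleton, Fin.ext_iff]
      simp only [doubleStarLevel] at h1 h2 h3
      grind
    have := Finset.card_le_card hsub
    rw [Finset.card_singleton] at this
    omega
  have hk2 : k < 2 * k := by omega
  by_cases hb : (⟨k, hk2⟩ : Fin (2 * k)) ∈ C
  · have hsub : C ⊆ insert ⟨k, hk2⟩ (Finset.Iio a) := by
      intro v hv
      have h1 := hadj _ hb v hv
      have h2 : v.val ≠ k - 1 := fun h => haC (Fin.ext (h.trans ha.symm) ▸ hv)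
      rw [Finset.mem_insert, Finset.mem_Iio, Fin.ext_iff, Fin.lt_def, ha]
      simp only [doubleStarLevel] at h1
      grind
    have hcard := Finset.card_insert_le (⟨k, hk2⟩ : Fin (2 * k)) (Finset.Iio a)
    rw [Finset.eq_of_subset_of_card_le hsub (by omega)]
    exact Finset.subset_insert _ _
  · have hsub : D ⊆ Finset.Iio a := by
      intro v hv
      have h1 := hD v hv
      have h2 : v.val ≠ k - 1 := fun h => haC (Fin.ext (h.trans ha.symm) ▸ hDC hv)
      have h3 : v.val ≠ k := fun h => hb ((Fin.ext h : v = ⟨k, hk2⟩) ▸ hDC hv)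
      rw [Finset.mem_Iio, Fin.lt_def, ha]
      simp only [doubleStarLevel] at h1
      grind
    rw [← Finset.eq_of_subset_of_card_le hsub (by omega)]
    exact hDC

theorem doubleStar_leaves_subset_of_move {k : ℕ} (hk : 3 ≤ k) {a : Fin (2 * k)}
    (ha : a.val = k - 1) {k' : ℕ} {C C' : Finset (Fin (2 * k))}
    (hC' : IsIS (levelGraph (doubleStarLevel k)) C') (hcard : C'.card = k)
    (hmove : TJMove (levelGraph (doubleStarLevel k)) k' 2 C C') (hC : Finset.Iio a ⊆ C) :
    Finset.Iio a ⊆ C' := by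
  obtain ⟨f, hf, hdist, -⟩ := hmove
  refine doubleStar_leaves_subset hk ha hC' hcard (D := (Finset.Iio a).image f) ?_ ?_ ?_
  · exact Finset.image_subset_iff.2 fun v hv => hf.mapsTo (hC hv)
  · rw [Finset.card_image_of_injOn (hf.injOn.mono (Finset.coe_subset.2 hC)), Fin.card_Iio, ha]
  · refine Finset.forall_mem_image.2 fun v hv => ?_
    have hle := levelGraph_level_le_add_dist (doubleStarLevel k)
      (doubleStar_connected (by omega)) v (f v)
    have hd := hdist v (hC hv)
    have hv0 : doubleStarLevel k v = 0 := by
      rw [Finset.mem_Iio, Fin.lt_def, ha] at hv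
      exact if_pos hv
    omega

theorem statement_15 (k : ℕ) (hk : 3 ≤ k) :
    ∃ (n : ℕ) (G : SimpleGraph (Fin n)) (Is It : Finset (Fin n)),
      G.Connected ∧ Is ≠ It ∧ Is.card = k ∧ It.card = k ∧
      IsIS G Is ∧ IsIS G It ∧
      ¬ ∃ (L : ℕ) (C : ℕ → Finset (Fin n)),
          C 0 = Is ∧ C L = It ∧
          (∀ i ≤ L, IsIS G (C i) ∧ (C i).card = k) ∧
          (∀ i < L, TJMove G k 2 (C i) (C (i + 1))) := by
  obtain ⟨a, ha⟩ : ∃ a : Fin (2 * k), a.val = k - 1 := ⟨⟨k - 1, by omega⟩, rfl⟩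
  obtain ⟨b, hb⟩ : ∃ b : Fin (2 * k), b.val = k := ⟨⟨k, by omega⟩, rfl⟩
  obtain ⟨x, hx⟩ : ∃ x : Fin (2 * k), x.val = 0 := ⟨⟨0, by omega⟩, rfl⟩
  obtain ⟨x', hx'⟩ : ∃ x' : Fin (2 * k), x'.val = 1 := ⟨⟨1, by omega⟩, rfl⟩
  obtain ⟨y, hy⟩ : ∃ y : Fin (2 * k), y.val = k + 1 := ⟨⟨k + 1, by omega⟩, rfl⟩
  have hnot : ¬ Finset.Iio a ⊆ insert x (Finset.Ioi b) := by
    intro hsub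
    have hmem := hsub (show x' ∈ Finset.Iio a by rw [Finset.mem_Iio, Fin.lt_def]; omega)
    rw [Finset.mem_insert, Finset.mem_Ioi, Fin.ext_iff, Fin.lt_def] at hmem
    omega
  refine ⟨2 * k, levelGraph (doubleStarLevel k), insert y (Finset.Iio a),
    insert x (Finset.Ioi b), doubleStar_connected (by omega), ?_, ?_, ?_, ?_, ?_, ?_⟩
  · exact fun heq => hnot (heq ▸ Finset.subset_insert _ _)
  · rw [Finset.card_insert_of_notMem (by rw [Finset.mem_Iio, Fin.lt_def]; omega), Fin.card_Iio]
    omega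
  · rw [Finset.card_insert_of_notMem (by rw [Finset.mem_Ioi, Fin.lt_def]; omega), Fin.card_Ioi]
    omega
  · intro u hu v hv
    rw [Finset.mem_insert, Finset.mem_Iio, Fin.ext_iff, Fin.lt_def] at hu hv
    simp only [levelGraph, doubleStarLevel]
    grind
  · intro u hu v hv
    rw [Finset.mem_insert, Finset.mem_Ioi, Fin.ext_iff, Fin.lt_def] at hu hv
    simp only [levelGraph, doubleStarLevel]
    grind
  · rintro ⟨L, C, h0, hL, hC, hmove⟩
    have hinv : ∀ i ≤ L, Finset.Iio a ⊆ C i := by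
      intro i
      induction i with
      | zero => exact fun _ => h0 ▸ Finset.subset_insert _ _
      | succ i ih =>
        intro hi
        exact doubleStar_leaves_subset_of_move hk ha (hC _ hi).1 (hC _ hi).2 (hmove i (by omega))
          (ih (by omega))
    exact hnot (hL ▸ hinv L le_rfl)
end

section
/- Let G be a split graph whose vertex set is partitioned into a clique C and an independent set I, and let I_s and I_t be two independent sets of G, each of size k. Then there exists a reconfiguration sequence from I_s to I_t under (1,1)-Token Jumping (single token slides) through independent sets of size k if and only if there exists such a reconfiguration sequence under (k,1)-Token Jumping (all tokens may simultaneously move by distance at most 1) through independent sets of size k. -/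
/-- A `(k', 1)`-Token Jumping move from `C` to `C'`: a bijection moving each token
by distance at most 1 (i.e. each token stays put or slides to an adjacent vertex),
with at most `k'` tokens actually moving. -/
def SlideMove {V : Type*} (G : SimpleGraph V) (k' : ℕ) (C C' : Finset V) : Prop :=
  ∃ f : V → V, Set.BijOn f ↑C ↑C' ∧ (∀ v ∈ C, f v = v ∨ G.Adj v (f v)) ∧
    {v | v ∈ C ∧ f v ≠ v}.ncard ≤ k'

/-- A move between two independent sets of size `k` shifting at most `k'` tokens. -/
def ISMove {V : Type*} (G : SimpleGraph V) (k k' : ℕ) (A B : Finset V) : Prop :=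
  (IsIS G A ∧ A.card = k) ∧ (IsIS G B ∧ B.card = k) ∧ SlideMove G k' A B

/-- Reconfiguration sequences are the same as reachability by moves. -/
theorem exists_sequence_iff_reflTransGen {V : Type*} (G : SimpleGraph V) (k k' : ℕ)
    {A B : Finset V} (hA : IsIS G A ∧ A.card = k) :
    (∃ (L : ℕ) (S : ℕ → Finset V), S 0 = A ∧ S L = B ∧
        (∀ i ≤ L, IsIS G (S i) ∧ (S i).card = k) ∧
        (∀ i < L, SlideMove G k' (S i) (S (i + 1)))) ↔
      Relation.ReflTransGen (ISMove G k k') A B := by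
  constructor
  · rintro ⟨L, S, rfl, rfl, hS, hmove⟩
    have reach : ∀ i ≤ L, Relation.ReflTransGen (ISMove G k k') (S 0) (S i) := by
      intro i
      induction i with
      | zero => exact fun _ => .refl
      | succ i ih =>
        exact fun hi => (ih (by omega)).tail ⟨hS i (by omega), hS _ hi, hmove i (by omega)⟩
    exact reach L le_rfl
  · intro h
    induction h with
    | refl => exact ⟨0, fun _ => A, rfl, rfl, fun _ _ => hA, fun i hi => absurd hi (by omega)⟩
    | @tail B D _ hBD ih =>
      obtain ⟨L, S, h0, hL, hS, hmove⟩ := ih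
      refine ⟨L + 1, fun i => if i ≤ L then S i else D, by simpa using h0, by simp, ?_, ?_⟩
      · intro i _
        by_cases h : i ≤ L
        · simpa [h] using hS i h
        · simpa [h] using hBD.2.1
      · intro i hi
        rcases Nat.lt_succ_iff_lt_or_eq.mp hi with h | rfl
        · simpa [h.le, Nat.succ_le_of_lt h] using hmove i h
        · simpa [hL] using hBD.2.2

theorem SlideMove.mono_card {V : Type*} {G : SimpleGraph V} {k' : ℕ} {A B : Finset V}
    (h : SlideMove G k' A B) : SlideMove G A.card A B := by
  obtain ⟨f, hf, hadj, -⟩ := h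
  refine ⟨f, hf, hadj, ?_⟩
  rw [← Set.ncard_coe_finset A]
  exact Set.ncard_le_ncard (fun v hv => hv.1) A.finite_toSet

/-- A bijection along closed neighbourhoods moving at most one vertex is a single slide. -/
theorem slideMove_one_of_subsingleton {V : Type*} {G : SimpleGraph V} {A B : Finset V}
    {f : V → V} (hf : Set.BijOn f ↑A ↑B) (hadj : ∀ v ∈ A, f v = v ∨ G.Adj v (f v))
    (hone : ∀ v ∈ A, ∀ w ∈ A, f v ≠ v → f w ≠ w → v = w) : SlideMove G 1 A B := by
  refine ⟨f, hf, hadj, ?_⟩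
  rw [Set.ncard_le_one_iff (A.finite_toSet.subset fun v hv => hv.1)]
  exact fun ha hb => hone _ ha.1 _ hb.1 ha.2 hb.2

/-- An independent set contains at most one vertex of a clique. -/
theorem IsIS.eq_of_mem_clique {V : Type*} {G : SimpleGraph V} {A : Finset V} {C : Set V}
    (hA : IsIS G A) (hC : G.IsClique C) {u v : V} (hu : u ∈ A) (hv : v ∈ A)
    (huC : u ∈ C) (hvC : v ∈ C) : u = v := by
  by_contra hne
  exact hA u hu v hv (hC huC hvC hne)

/-- In a split graph, a simultaneous move decomposes into single slides. -/
theorem ISMove.reflTransGen_one {V : Type*} {G : SimpleGraph V} {C I : Set V}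
    (hpart : ∀ v : V, v ∈ C ∨ v ∈ I) (hdisj : Disjoint C I)
    (hC : G.IsClique C) (hI : ∀ u ∈ I, ∀ v ∈ I, ¬ G.Adj u v)
    {k k' : ℕ} {A B : Finset V} (h : ISMove G k k' A B) :
    Relation.ReflTransGen (ISMove G k 1) A B := by
  classical
  obtain ⟨⟨hA, hAk⟩, ⟨hB, hBk⟩, f, hf, hadj, -⟩ := h
  have hmaps : ∀ v ∈ A, f v ∈ B := fun v hv => hf.mapsTo hv
  have hinj : ∀ v ∈ A, ∀ w ∈ A, f v = f w → v = w := fun v hv w hw => hf.injOn hv hw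
  have henter : ∀ v ∈ A, v ∈ I → f v ≠ v → f v ∈ C := fun v hv hvI hne =>
    (hpart (f v)).resolve_right fun hfI => hI v hvI _ hfI ((hadj v hv).resolve_left hne)
  by_cases hleave : ∃ u ∈ A, u ∈ C ∧ f u ∈ I
  · obtain ⟨u, huA, huC, hfuI⟩ := hleave
    have hfu : f u ≠ u := fun e => Set.disjoint_left.mp hdisj huC (e ▸ hfuI)
    have huadj : G.Adj u (f u) := (hadj u huA).resolve_left hfu
    have hfuA : f u ∉ A := fun hm => hA u huA _ hm huadj
    have hrest : ∀ v ∈ A, v ≠ u → v ∈ I := fun v hv hne =>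
      (hpart v).resolve_left fun hvC => hne (hA.eq_of_mem_clique hC hv huA hvC huC)
    set M : Finset V := insert (f u) (A.erase u) with hM
    have hMI : ∀ v ∈ M, v ∈ I := by
      intro v hv
      rcases Finset.mem_insert.mp hv with rfl | hv
      · exact hfuI
      · exact hrest v (Finset.mem_of_mem_erase hv) (Finset.ne_of_mem_erase hv)
    have hMis : IsIS G M := fun v hv w hw => hI v (hMI v hv) w (hMI w hw)
    have hMk : M.card = k := by
      rw [hM, Finset.card_insert_of_notMem (fun hm => hfuA (Finset.mem_of_mem_erase hm)),
        Finset.card_erase_add_one huA, hAk]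
    have hAM : SlideMove G 1 A M := by
      refine slideMove_one_of_subsingleton (f := Function.update id u (f u))
        ⟨?_, ?_, ?_⟩ ?_ ?_
      · intro v hv
        by_cases e : v = u <;> simp_all
      · intro v hv w hw
        by_cases e : v = u <;> by_cases e' : w = u <;> simp_all <;> grind
      · intro w hw
        rcases Finset.mem_insert.mp hw with rfl | hw
        · exact ⟨u, huA, by simp⟩
        · exact ⟨w, Finset.mem_of_mem_erase hw, by simp [Finset.ne_of_mem_erase hw]⟩
      · intro v _
        by_cases e : v = u <;> simp_all
      · intro v _ w _
        by_cases e : v = u <;> by_cases e' : w = u <;> simp_all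
    have hMB : SlideMove G 1 M B := by
      have hval : ∀ v ∈ A, Function.update f (f u) (f u) v = f v := fun v hv =>
        Function.update_of_ne (ne_of_mem_of_not_mem hv hfuA) _ _
      have hmem : ∀ v ∈ M, v = f u ∨ v ∈ A ∧ v ≠ u := by
        intro v hv
        simpa [hM, and_comm] using hv
      refine slideMove_one_of_subsingleton (f := Function.update f (f u) (f u))
        ⟨?_, ?_, ?_⟩ ?_ ?_
      · intro v hv
        rcases hmem v hv with rfl | ⟨hv, -⟩
        · simpa using hmaps u huA
        · rw [hval v hv]
          exact hmaps v hv
      · intro v hv w hw e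
        rcases hmem v hv with rfl | ⟨hv, hvu⟩ <;> rcases hmem w hw with rfl | ⟨hw, hwu⟩
        · rfl
        · rw [hval w hw, Function.update_self] at e
          exact absurd (hinj u huA w hw e).symm hwu
        · rw [hval v hv, Function.update_self] at e
          exact absurd (hinj v hv u huA e) hvu
        · rw [hval v hv, hval w hw] at e
          exact hinj v hv w hw e
      · intro b hb
        obtain ⟨v, hv, rfl⟩ := hf.surjOn hb
        by_cases e : v = u
        · subst e
          exact ⟨f v, by simp [hM], by simp⟩
        · exact ⟨v, Finset.mem_insert_of_mem (Finset.mem_erase.mpr ⟨e, hv⟩), hval v hv⟩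
      · intro v hv
        rcases hmem v hv with rfl | ⟨hv, -⟩
        · simp
        · rw [hval v hv]
          exact hadj v hv
      · intro v hv w hw hv' hw'
        rcases hmem v hv with rfl | ⟨hv, hvu⟩
        · simp at hv'
        rcases hmem w hw with rfl | ⟨hw, hwu⟩
        · simp at hw'
        rw [hval v hv] at hv'
        rw [hval w hw] at hw'
        exact hinj v hv w hw (hB.eq_of_mem_clique hC (hmaps v hv) (hmaps w hw)
          (henter v hv (hrest v hv hvu) hv') (henter w hw (hrest w hw hwu) hw'))
    exact (Relation.ReflTransGen.single ⟨⟨hA, hAk⟩, ⟨hMis, hMk⟩, hAM⟩).tail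
      ⟨⟨hMis, hMk⟩, ⟨hB, hBk⟩, hMB⟩
  · have hend : ∀ v ∈ A, f v ≠ v → f v ∈ C := fun v hv hne =>
      (hpart v).elim
        (fun hvC => (hpart (f v)).resolve_right fun hfI => hleave ⟨v, hv, hvC, hfI⟩)
        (fun hvI => henter v hv hvI hne)
    exact .single ⟨⟨hA, hAk⟩, ⟨hB, hBk⟩, slideMove_one_of_subsingleton hf hadj
      fun v hv w hw hv' hw' => hinj v hv w hw (hB.eq_of_mem_clique hC (hmaps v hv) (hmaps w hw)
        (hend v hv hv') (hend w hw hw'))⟩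

theorem statement_16 {V : Type*} (G : SimpleGraph V)
    (C I : Set V) (hpart : ∀ v : V, v ∈ C ∨ v ∈ I) (hdisj : Disjoint C I)
    (hC : G.IsClique C) (hI : ∀ u ∈ I, ∀ v ∈ I, ¬ G.Adj u v)
    (k : ℕ) (Is It : Finset V) (hIsI : IsIS G Is) (hItI : IsIS G It)
    (hs : Is.card = k) (ht : It.card = k) :
    (∃ (L : ℕ) (S : ℕ → Finset V),
        S 0 = Is ∧ S L = It ∧
        (∀ i ≤ L, IsIS G (S i) ∧ (S i).card = k) ∧
        (∀ i < L, SlideMove G 1 (S i) (S (i + 1)))) ↔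
    (∃ (L : ℕ) (S : ℕ → Finset V),
        S 0 = Is ∧ S L = It ∧
        (∀ i ≤ L, IsIS G (S i) ∧ (S i).card = k) ∧
        (∀ i < L, SlideMove G k (S i) (S (i + 1)))) := by
  rw [exists_sequence_iff_reflTransGen G k 1 ⟨hIsI, hs⟩,
    exists_sequence_iff_reflTransGen G k k ⟨hIsI, hs⟩]
  constructor
  · intro h
    exact h.lift id fun A B h => ⟨h.1, h.2.1, h.1.2 ▸ h.2.2.mono_card⟩
  · intro h
    clear hItI ht
    induction h with
    | refl => exact .refl
    | tail _ hstep ih => exact ih.trans (hstep.reflTransGen_one hpart hdisj hC hI)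
end
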